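/- Arithmetical Theorem: there exists a real number λ with 1.3035 < λ < 1.3036 such that for every nonempty word x over the positive integers with x ≠ (2,2), the ratio of lengths |C^{n+1}(x)| / |C^n(x)| converges to λ as n → ∞. -/

import Mathlib

/-- The look-and-say (audioactive) derivation: replace each maximal run of
`k` consecutive equal symbols `a` in the word by the two symbols `k, a`. -/
def lookAndSay (x : List ℕ+) : List ℕ+ :=
  (x.splitBy (· == ·)).flatMap fun r => [r.length.toPNat', r.headD 1]

set_option maxRecDepth 100000

namespace LS

/-! ### Definitions (written with recursors so that the kernel evaluates them quickly) -/

/-- Prepend one letter to a word, on the level of its derivation. -/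
noncomputable def push (a : ℕ) (l : List ℕ) : List ℕ :=
  List.rec [1, a] (fun k t _ => List.rec [1, a] (fun b r _ =>
    Bool.rec (1 :: a :: k :: b :: r) (Nat.succ k :: b :: r) (Nat.beq a b)) t) l

/-- The audioactive derivation on words over `ℕ`. -/
noncomputable def C (x : List ℕ) : List ℕ := List.rec [] (fun a _ r => push a r) x

/-- The word does not start with `z`. -/
noncomputable def hdne (z : ℕ) (v : List ℕ) : Bool :=
  List.rec true (fun c _ _ => Bool.rec true false (Nat.beq c z)) v

/-- What may follow an initial `1` in a word of Conway's starting class. -/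
noncomputable def st1 (v : List ℕ) : Bool :=
  List.rec false (fun b t _ => Bool.rec (hdne b t)
    (List.rec false (fun c u _ => Bool.rec false (hdne 1 u) (Nat.beq c 1)) t) (Nat.beq b 1)) v

/-- What may follow an initial `3` in a word of Conway's starting class. -/
noncomputable def st3 (v : List ℕ) : Bool :=
  List.rec true (fun b t _ => Bool.rec
    (List.rec true (fun c u _ => Bool.rec true (hdne b u) (Nat.beq c b)) t) false (Nat.beq b 3)) v

/-- Words whose derivations never start with `2` (by Conway's starting theorem). -/
noncomputable def stA (v : List ℕ) : Bool :=
  List.rec false (fun a t _ => Bool.rec (Bool.rec false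
    (st3 t) (Nat.beq a 3)) (st1 t) (Nat.beq a 1)) v

noncomputable def stB2 (v : List ℕ) : Bool := List.rec true (fun _ _ _ => stA v) v

noncomputable def stB1 (v : List ℕ) : Bool :=
  List.rec false (fun b w _ => Bool.rec false (stB2 w) (Nat.beq b 2)) v

/-- Words `22` or `22w` with `w` in the class `stA`: all derivations start with `2`. -/
noncomputable def stB (v : List ℕ) : Bool :=
  List.rec false (fun b w _ => Bool.rec false (stB1 w) (Nat.beq b 2)) v

/-- Conway's splitting criterion: a word ending in `a` splits from the word `v`. -/
noncomputable def sp (a : ℕ) (v : List ℕ) : Bool := Bool.rec (stB v) (stA v) (Nat.beq a 2)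

noncomputable def consHead (a : ℕ) (l : List (List ℕ)) : List (List ℕ) :=
  List.rec [[a]] (fun b bs _ => (a :: b) :: bs) l

/-- The pieces of a word after cutting at all split positions. -/
noncomputable def atoms (x : List ℕ) : List (List ℕ) :=
  List.rec [] (fun a t r => Bool.rec (consHead a r) ([a] :: r) (sp a t)) x

/-- Number of leading letters `z`. -/
noncomputable def lead (z : ℕ) (x : List ℕ) : ℕ :=
  List.rec 0 (fun a _ r => Bool.rec 0 (Nat.succ r) (Nat.beq z a)) x

/-- Drop the leading letters `z`. -/
noncomputable def drp (z : ℕ) (x : List ℕ) : List ℕ :=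
  List.rec [] (fun a t r => Bool.rec (a :: t) r (Nat.beq z a)) x

/-- All runs of the word have length at most three. -/
noncomputable def r3 (x : List ℕ) : Bool :=
  List.rec true (fun a t r => Bool.rec false r (Nat.ble (lead a t) 2)) x

/-- Word equality. -/
noncomputable def leq (x : List ℕ) : List ℕ → Bool :=
  List.rec (fun y => List.rec true (fun _ _ _ => false) y)
    (fun a _ r y => List.rec false (fun b u _ => Bool.rec false (r u) (Nat.beq a b)) y) x

/-- The word with the given decimal digits. -/
noncomputable def decAux (f : ℕ) : ℕ → List ℕ → List ℕ :=
  Nat.rec (fun _ acc => acc) (fun _ g n acc =>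
    Bool.rec (g (Nat.div n 10) (Nat.mod n 10 :: acc)) acc (Nat.beq n 0)) f

noncomputable def dec (n : ℕ) : List ℕ := decAux 60 n []

/-- The decimal number with the given digits. -/
noncomputable def code (x : List ℕ) : ℕ :=
  List.rec (fun n => n) (fun a _ r n => r (Nat.add (Nat.mul n 10) a)) x 0

/-- Binary search trees of (decimal codes of) words. -/
inductive BT where
  | lf : BT
  | bn (l : BT) (n : ℕ) (r : BT) : BT

noncomputable def BT.memc (b : List ℕ) (c : ℕ) (t : BT) : Bool :=
  BT.rec false (fun _ n _ l r =>
    Bool.rec (Bool.rec r l (Nat.ble c n)) (leq b (dec n)) (Nat.beq c n)) t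

noncomputable def BT.toL (t : BT) : List ℕ := BT.rec [] (fun _ n _ l r => l ++ n :: r) t

open BT in
/-- Conway's elements: the 92 common ones and the two transuranic ones (with last letter `4`). -/
def ebt : BT :=
  bn (bn (bn (bn (bn (bn (bn lf 3 lf) 12 lf) 13 (bn (bn lf 22 lf) 132 lf)) 312 (bn (bn (bn lf 1112
  lf) 1113 lf) 3112 (bn (bn lf 3113 lf) 11131 lf))) 11132 (bn (bn (bn (bn lf 13211 lf) 31132 lf)
  32112 (bn (bn lf 111312 lf) 131112 lf)) 132112 (bn (bn (bn lf 132113 lf) 311311 lf) 311312 (bn (bn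
  lf 311332 lf) 1112133 lf)))) 1113222 (bn (bn (bn (bn (bn lf 1321132 lf) 1322112 lf) 1322113 (bn (bn
  lf 3112112 lf) 3112221 lf)) 11131221 (bn (bn (bn lf 11133112 lf) 13122112 lf) 13211312 (bn (bn lf
  13211321 lf) 31131112 lf))) 123222112 (bn (bn (bn (bn lf 123222113 lf) 311311222 lf) 1113122112 (bn
  (bn lf 1113122113 lf) 1113222112 lf)) 1113222113 (bn (bn (bn lf 1321122112 lf) 1321131112 lf)
  1321133112 (bn (bn lf 3113112211 lf) 3113322112 lf))))) 3113322113 (bn (bn (bn (bn (bn (bn lf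
  13221133112 lf) 111213322112 lf) 111213322113 (bn (bn lf 111311222112 lf) 111312211312 lf))
  132113212221 (bn (bn (bn lf 311311222112 lf) 311311222113 lf) 1322113312211 (bn (bn lf
  11131221131112 lf) 11131221131211 lf))) 11131221133112 (bn (bn (bn (bn lf 11131221222112 lf)
  31121123222112 lf) 31121123222113 (bn (bn lf 311322113212221 lf) 3113112211322112 lf))
  3113112221131112 (bn (bn (bn lf 3113112221133112 lf) 13221133122211332 lf) 111312211312113211 (bn
  (bn lf 132112211213322112 lf) 132112211213322113 lf)))) 311311222113111221 (bn (bn (bn (bn (bn lf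
  13211321222113222112 lf) 13211322211312113211 lf) 132211331222113112211 (bn (bn lf
  12322211331222113112211 lf) 31131122211311122113222 lf)) 111312212221121123222112 (bn (bn (bn lf
  111312212221121123222113 lf) 311311222113111221131221 lf) 11131221131211322113322112 (bn (bn lf
  312211322212221121123222112 lf) 312211322212221121123222113 lf))) 312211322212221121123222114 (bn
  (bn (bn (bn lf 1113122113322113111221131221 lf) 3113112211322112211213322112 lf)
  3113112211322112211213322113 (bn (bn lf 13112221133211322112211213322112 lf)
  13112221133211322112211213322113 lf)) 13112221133211322112211213322114 (bn (bn (bn lf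
  1321132122211322212221121123222112 lf) 1321132122211322212221121123222113 lf)
  111312211312113221133211322112211213322112 (bn lf 111312211312113221133211322112211213322113
  lf)))))

noncomputable def isE (b : List ℕ) : Bool := ebt.memc b (code b)

/-- The word decays into elements within `n` days. -/
noncomputable def good (n : ℕ) : List ℕ → Bool :=
  Nat.rec (fun _ => false) (fun _ g x => List.rec true (fun b _ r =>
    Bool.rec (Bool.rec false r (g b)) r (isE b)) (atoms (C x))) n

/-- Search a common split of `S c A` and `S c B`. -/
noncomputable def cutHere (c : ℕ) (A B : List ℕ) : Bool :=
  Bool.rec false (List.rec true (fun _ _ _ => Bool.rec false (good 24 A) (sp c A)) A)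
    (List.rec true (fun _ _ _ => sp c B) B)

noncomputable def cut (A : List ℕ) : ℕ → List ℕ → Bool :=
  List.rec (fun c B => cutHere c [] B)
    (fun a A' r c B => Bool.rec
      (List.rec false (fun b B' _ => Bool.rec false (r a B') (Nat.beq a b)) B) true
      (cutHere c (a :: A') B)) A

/-- The words `S A` and `S B` become the same up to split-off good pieces after `t` days. -/
noncomputable def pchk (t : ℕ) : List ℕ → List ℕ → Bool :=
  Nat.rec
    (fun A B => List.rec false (fun a A' _ => List.rec false (fun b B' _ =>
      Bool.rec false (cut A' a B') (Nat.beq a b)) B) A)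
    (fun _ g A B => List.rec false (fun a A' _ => List.rec false (fun b B' _ =>
      Bool.rec false (Bool.rec false (g (a :: C (drp a A')) (a :: C (drp a B')))
        (Nat.beq (lead a A') (lead a B'))) (Nat.beq a b)) B) A) t

/-- The automaton reading words from right to left: `nd` is a state (with its three transitions),
`rd t s` means that the word may be replaced by the state `s`, as seen after `t` days, and `no`
marks words starting with a run of length four. -/
inductive Tr where
  | no : Tr
  | rd (t s : ℕ) : Tr
  | nd (x y z : Tr) : Tr

open Tr in
/-- States not ending in `4`. -/
def t0 : Tr :=
  nd (nd (nd (nd no (rd 0 2) (nd (nd (nd (nd no (rd 0 2) (nd (rd 2 13111) (rd 2 23111) (nd (rd 2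
  133111) (rd 2 233111) (nd (rd 3 1333111) (rd 3 2333111) no)))) (rd 2 233111) (nd (rd 8 13114) (rd 0
  2) (nd (rd 1 133) (rd 1 233) (nd (rd 2 1333) (rd 2 2333) no)))) (rd 0 2) (nd (nd (nd (nd no (rd 0
  2) (rd 3 3111314)) (rd 3 211314) (rd 4 3114)) (rd 0 2) (rd 3 31314)) (rd 0 2) (nd (rd 9 13322114)
  (rd 11 23322114) (nd (nd (nd (nd no (rd 0 2) (rd 13 311133314)) (rd 10 21133322114) (rd 9 311333))
  (rd 2 2333) (rd 2 31333)) (nd (rd 8 1233314) (nd (nd (nd (nd no (rd 0 2) (rd 3 3111221)) (rd 3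
  211221) (rd 3 311221)) (rd 8 212233322114) (rd 9 31221)) (nd (rd 8 12221) no (rd 4 3222133)) (nd
  (rd 4 134) (rd 0 2) (nd (rd 1 133) (rd 1 233) (nd (rd 4 13334) (rd 4 23334) no)))) (rd 8 32133))
  no)))) (nd (nd (nd (nd no (rd 0 2) (rd 5 31114)) (nd (rd 6 121134) (nd (rd 5 1221134) (nd (rd 6
  12221134) no (nd (rd 10 13222114) (rd 10 2311133) (nd (rd 9 133222114) (rd 12 233222114) (nd (rd 6
  13332221134) (rd 6 23332221134) no)))) (nd (rd 5 1313111) (rd 0 2) (nd (rd 9 13322114) (rd 11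
  23322114) (nd (rd 5 133313111) (rd 5 233313111) no)))) (rd 3 32114)) (rd 4 3114)) (rd 0 2) (nd (rd
  3 1314) (rd 0 2) (nd (rd 3 13314) (rd 3 23314) (nd (rd 3 133314) (rd 3 233314) no)))) (nd (nd (nd
  (nd no (rd 0 2) (nd (rd 2 13111) (rd 2 23111) (nd (rd 2 133111) (rd 2 233111) (nd (rd 3 1333111)
  (rd 3 2333111) no)))) (nd (rd 11 1211) (nd (rd 9 12211) (nd (rd 5 1222) no (nd (rd 2 13111) (rd 2
  23111) (nd (rd 2 133111) (rd 2 233111) (nd (rd 5 1333222) (rd 5 2333222) no)))) (rd 13 32211)) (rd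
  10 3211)) (rd 6 311)) (nd (nd (nd (nd no (rd 0 2) (rd 5 311121)) (rd 5 21121) (rd 4 3114)) (rd 0 2)
  (rd 5 3121)) (nd (rd 10 1221) (nd (rd 8 12221) no (rd 11 32221)) (nd (rd 4 134) (rd 0 2) (nd (rd 1
  133) (rd 1 233) (nd (rd 4 13334) (rd 4 23334) no)))) (rd 5 321)) (nd (rd 6 131) (rd 0 2) (nd (rd 1
  133) (rd 1 233) (nd (rd 2 1333) (rd 2 2333) no)))) (nd (rd 5 1222) no (nd (rd 2 13111) (rd 2 23111)
  (nd (rd 2 133111) (rd 2 233111) (nd (rd 5 1333222) (rd 5 2333222) no)))) (nd (nd (nd (nd no (rd 0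
  2) (rd 5 31114)) (rd 5 211311) (rd 4 3114)) (rd 0 2) (rd 6 314)) (rd 0 2) (nd (rd 1 133) (rd 1 233)
  (nd (rd 2 1333) (rd 2 2333) no)))) (nd (rd 4 134) (rd 0 2) (nd (rd 1 133) (rd 1 233) (nd (rd 4
  13334) (rd 4 23334) no)))) (nd (nd (nd (nd no (rd 0 2) (nd (rd 4 1311133) (rd 4 2311133) (nd (rd 4
  13311133) (rd 4 23311133) (nd (rd 4 133311133) (rd 4 233311133) no)))) (rd 1 233) (rd 1 31133)) (nd
  (nd (nd (nd no (rd 0 2) (rd 13 311121)) (nd (nd (nd (nd no (rd 0 2) (rd 10 31112114)) (rd 7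
  21121121) (rd 12 311211)) (rd 0 2) (rd 7 312114)) (nd (rd 5 1221134) (nd (rd 4 12221121) no (nd (rd
  4 1311133) (rd 4 2311133) (nd (rd 4 13311133) (rd 4 23311133) (nd (rd 4 133311133) (rd 4 233311133)
  no)))) (rd 7 322112133)) (rd 3 32114)) (rd 4 3114)) (rd 0 2) (rd 11 312133)) (nd (rd 7 122333) (nd
  (rd 8 12221) no (rd 4 3222133)) (nd (rd 4 134) (rd 0 2) (nd (rd 1 133) (rd 1 233) (nd (rd 4 13334)
  (rd 4 23334) no)))) (rd 8 32133)) (nd (rd 9 13133) (rd 0 2) (nd (rd 1 133) (rd 1 233) (nd (rd 2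
  1333) (rd 2 2333) no)))) (nd (rd 7 121121) (nd (nd (nd (nd no (rd 0 2) (rd 6 3111333)) (nd (rd 15
  1211333) (nd (rd 9 12211) (nd (rd 13 122211333) no (nd (rd 2 13111) (rd 2 23111) (nd (rd 2 133111)
  (rd 2 233111) (nd (rd 11 133322211333) (rd 13 233322211333) no)))) (rd 5 32211333)) (rd 11 3211))
  (rd 8 311333)) (rd 2 2333) (rd 2 31333)) (nd (rd 4 12221121) no (nd (rd 4 1311133) (rd 4 2311133)
  (nd (rd 4 13311133) (rd 4 23311133) (nd (rd 4 133311133) (rd 4 233311133) no)))) (nd (rd 3 1314)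
  (rd 0 2) (nd (rd 3 13314) (rd 3 23314) (nd (rd 3 133314) (rd 3 233314) no)))) (rd 3 32114)) (nd (nd
  (nd (nd no (rd 0 2) (rd 3 3111221)) (rd 3 211221) (rd 3 311221)) (nd (rd 16 121221) (nd (rd 10
  1221) (nd (rd 8 12221) no (rd 12 32221)) (rd 6 3221221)) (rd 5 321)) (rd 9 31221)) (nd (nd (nd (nd
  no (rd 0 2) (rd 5 31114)) (nd (rd 6 121134) (nd (rd 5 1221134) (nd (rd 6 12221134) no (nd (rd 10
  13222114) (rd 10 2311133) (nd (rd 9 133222114) (rd 12 233222114) (nd (rd 6 13332221134) (rd 6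
  23332221134) no)))) (nd (rd 5 1313111) (rd 0 2) (nd (rd 9 13322114) (rd 11 23322114) (nd (rd 5
  133313111) (rd 5 233313111) no)))) (rd 3 32114)) (rd 4 3114)) (rd 0 2) (rd 14 3123111)) (nd (nd (nd
  (nd no (rd 0 2) (rd 11 3111223111)) (nd (rd 11 1211) (nd (rd 9 12211) (nd (rd 5 1222) no (rd 7
  322211223111)) (rd 13 32211)) (rd 10 3211)) (rd 6 311)) (rd 4 21223111) (rd 4 31223111)) (nd (rd 5
  1222) no (nd (rd 2 13111) (rd 2 23111) (nd (rd 2 133111) (rd 2 233111) (nd (rd 5 1333222) (rd 5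
  2333222) no)))) (nd (rd 5 1311) (rd 0 2) (nd (rd 1 133) (rd 1 233) (nd (rd 2 1333) (rd 2 2333)
  no)))) (nd (rd 4 134) (rd 0 2) (nd (rd 1 133) (rd 1 233) (nd (rd 4 13334) (rd 4 23334) no))))
  no)))) (nd (nd (nd (nd no (rd 0 2) (nd (rd 2 13111) (rd 2 23111) (nd (rd 2 133111) (rd 2 233111)
  (nd (rd 3 1333111) (rd 3 2333111) no)))) (nd (nd (nd (nd no (rd 0 2) (rd 10 31112114)) (nd (rd 10
  1211211) (nd (rd 14 12211211314) (nd (rd 4 12221121) no (rd 6 3222112114)) (nd (rd 3 1314) (rd 0 2)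
  (nd (rd 3 13314) (rd 3 23314) (nd (rd 3 133314) (rd 3 233314) no)))) (rd 3 32114)) (rd 12 311211))
  (rd 0 2) (rd 7 312114)) (nd (rd 6 12233) (nd (rd 4 12221121) no (nd (rd 4 1311133) (rd 4 2311133)
  (nd (rd 4 13311133) (rd 4 23311133) (nd (rd 4 133311133) (rd 4 233311133) no)))) (nd (rd 3 1314)
  (rd 0 2) (nd (rd 3 13314) (rd 3 23314) (nd (rd 3 133314) (rd 3 233314) no)))) (rd 3 32114)) (nd (rd
  8 13114) (rd 0 2) (nd (rd 1 133) (rd 1 233) (nd (rd 2 1333) (rd 2 2333) no)))) (rd 0 2) (nd (rd 3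
  1314) (rd 0 2) (nd (rd 3 13314) (rd 3 23314) (nd (rd 3 133314) (rd 3 233314) no)))) (nd (nd (nd (nd
  no (rd 0 2) (rd 6 3111333)) (nd (rd 15 1211333) (nd (rd 9 12211) (nd (rd 13 122211333) no (nd (rd 2
  13111) (rd 2 23111) (nd (rd 2 133111) (rd 2 233111) (nd (rd 11 133322211333) (rd 13 233322211333)
  no)))) (rd 5 32211333)) (rd 11 3211)) (rd 8 311333)) (rd 2 2333) (rd 2 31333)) (nd (rd 5 1222) no
  (nd (rd 2 13111) (rd 2 23111) (nd (rd 2 133111) (rd 2 233111) (nd (rd 5 1333222) (rd 5 2333222)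
  no)))) (nd (rd 3 1314) (rd 0 2) (nd (rd 3 13314) (rd 3 23314) (nd (rd 3 133314) (rd 3 233314)
  no)))) (nd (nd (nd (nd no (rd 0 2) (rd 5 31114)) (nd (rd 8 121131) (nd (rd 13 122114) (nd (rd 12
  1222114) no (nd (rd 10 13222114) (rd 10 2311133) (nd (rd 9 133222114) (rd 12 233222114) (nd (rd 11
  1333222114) (rd 14 2333222114) no)))) (nd (rd 11 1322114) (rd 0 2) (nd (rd 9 13322114) (rd 11
  23322114) (nd (rd 10 133322114) (rd 13 233322114) no)))) (rd 3 32114)) (rd 4 3114)) (rd 0 2) (rd 6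
  314)) (rd 0 2) (nd (rd 1 133) (rd 1 233) (nd (rd 2 1333) (rd 2 2333) no)))) (nd (nd (nd (nd no (rd
  0 2) (rd 5 31114)) (nd (rd 6 121134) (nd (rd 7 1221131) (nd (rd 6 12221134) no (nd (rd 10 13222114)
  (rd 10 2311133) (nd (rd 9 133222114) (rd 12 233222114) (nd (rd 6 13332221134) (rd 6 23332221134)
  no)))) (nd (rd 11 1322114) (rd 0 2) (nd (rd 9 13322114) (rd 11 23322114) (nd (rd 10 133322114) (rd
  13 233322114) no)))) (rd 3 32114)) (rd 4 3114)) (rd 0 2) (rd 6 314)) (rd 0 2) (nd (rd 1 133) (rd 1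
  233) (nd (rd 2 1333) (rd 2 2333) no)))) (nd (nd (nd (nd no (rd 0 2) (nd (rd 2 13111) (rd 2 23111)
  (nd (rd 2 133111) (rd 2 233111) (nd (rd 3 1333111) (rd 3 2333111) no)))) (nd (nd (nd (nd no (rd 0
  2) (rd 10 31112114)) (nd (rd 10 1211211) (nd (rd 8 122112114) (nd (rd 4 12221121) no (rd 6
  3222112114)) (nd (rd 3 1314) (rd 0 2) (nd (rd 3 13314) (rd 3 23314) (nd (rd 3 133314) (rd 3 233314)
  no)))) (rd 3 32114)) (rd 12 311211)) (rd 0 2) (rd 7 312114)) (nd (rd 5 1221134) (nd (nd (nd (nd no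
  (rd 0 2) (rd 4 3111222114)) (rd 1 233) (rd 1 31133)) (rd 4 21222114) (rd 5 3133)) no (nd (rd 4
  1311133) (rd 4 2311133) (nd (rd 4 13311133) (rd 4 23311133) (nd (rd 4 133311133) (rd 4 233311133)
  no)))) (nd (rd 5 1313111) (rd 0 2) (nd (rd 9 13322114) (rd 11 23322114) (nd (rd 5 133313111) (rd 5
  233313111) no)))) (rd 3 32114)) (rd 4 3114)) (rd 0 2) (nd (rd 3 1314) (rd 0 2) (nd (rd 3 13314) (rd
  3 23314) (nd (rd 3 133314) (rd 3 233314) no)))) (nd (nd (nd (nd no (rd 0 2) (nd (rd 2 13111) (rd 2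
  23111) (nd (rd 2 133111) (rd 2 233111) (nd (rd 3 1333111) (rd 3 2333111) no)))) (nd (nd (nd (nd no
  (rd 0 2) (rd 4 3111211)) (rd 4 211211) (rd 4 311211)) (rd 0 2) (rd 4 31211)) (nd (rd 9 12211) (nd
  (rd 5 1222) no (nd (rd 2 13111) (rd 2 23111) (nd (rd 2 133111) (rd 2 233111) (nd (rd 5 1333222) (rd
  5 2333222) no)))) (nd (rd 3 1314) (rd 0 2) (nd (rd 3 13314) (rd 3 23314) (nd (rd 3 133314) (rd 3
  233314) no)))) (rd 10 3211)) (nd (rd 5 1311) (rd 0 2) (nd (rd 1 133) (rd 1 233) (nd (rd 2 1333) (rd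
  2 2333) no)))) (nd (nd (nd (nd no (rd 0 2) (rd 5 311121)) (rd 5 21121) (rd 4 3114)) (rd 0 2) (rd 5
  3121)) (nd (rd 10 1221) (nd (rd 8 12221) no (rd 12 32221)) (nd (rd 4 134) (rd 0 2) (nd (rd 1 133)
  (rd 1 233) (nd (rd 4 13334) (rd 4 23334) no)))) (rd 5 321)) (nd (rd 6 131) (rd 0 2) (nd (rd 1 133)
  (rd 1 233) (nd (rd 2 1333) (rd 2 2333) no)))) (nd (nd (nd (nd no (rd 0 2) (rd 7 311133)) (rd 1 233)
  (rd 1 31133)) (nd (nd (nd (nd no (rd 0 2) (rd 13 311121)) (rd 7 2112133) (rd 4 3114)) (rd 0 2) (rd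
  7 312133)) (nd (rd 14 122133) (nd (rd 8 12221) no (rd 4 3222133)) (nd (rd 12 1322133) (rd 0 2) (nd
  (rd 1 133) (rd 1 233) (nd (rd 10 133322133) (rd 12 233322133) no)))) (rd 7 32133)) (rd 5 3133)) no
  (nd (rd 2 13111) (rd 2 23111) (nd (rd 2 133111) (rd 2 233111) (nd (rd 3 1333111) (rd 3 2333111)
  no)))) (nd (rd 4 134) (rd 0 2) (nd (rd 1 133) (rd 1 233) (nd (rd 4 13334) (rd 4 23334) no)))) (nd
  (rd 4 134) (rd 0 2) (nd (rd 1 133) (rd 1 233) (nd (rd 4 13334) (rd 4 23334) no)))) (nd (nd (nd (nd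
  no (rd 0 2) (rd 5 31114)) (nd (nd (nd (nd no (rd 0 2) (rd 6 31112114)) (rd 6 2112114) (rd 12
  311211)) (rd 0 2) (rd 6 312114)) (nd (nd (nd (nd no (rd 0 2) (rd 6 3111333)) (rd 5 21122114) (rd 9
  311333)) (rd 2 2333) (rd 2 31333)) (nd (rd 12 1222114) no (nd (rd 10 13222114) (rd 10 2311133) (nd
  (rd 9 133222114) (rd 12 233222114) (nd (rd 11 1333222114) (rd 14 2333222114) no)))) (nd (rd 11
  1322114) (rd 0 2) (nd (rd 9 13322114) (rd 11 23322114) (nd (rd 10 133322114) (rd 13 233322114)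
  no)))) (rd 3 32114)) (rd 4 3114)) (rd 0 2) (rd 6 314)) (rd 0 2) (nd (rd 1 133) (rd 1 233) (nd (rd 2
  1333) (rd 2 2333) no)))) (nd (nd (nd (nd no (rd 0 2) (rd 5 31114)) (nd (rd 14 12114) (nd (rd 13
  122114) (nd (rd 12 1222114) no (nd (rd 10 13222114) (rd 10 2311133) (nd (rd 9 133222114) (rd 12
  233222114) (nd (rd 11 1333222114) (rd 14 2333222114) no)))) (nd (rd 11 1322114) (rd 0 2) (nd (rd 9
  13322114) (rd 11 23322114) (nd (rd 10 133322114) (rd 13 233322114) no)))) (rd 3 32114)) (rd 4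
  3114)) (rd 0 2) (rd 6 314)) (nd (rd 0 1) (nd (nd (nd (nd no (rd 0 2) (nd (rd 4 1311133) (rd 4
  2311133) (nd (rd 4 13311133) (rd 4 23311133) (nd (rd 4 133311133) (rd 4 233311133) no)))) (rd 1
  233) (rd 1 31133)) (nd (nd (nd (nd no (rd 0 2) (rd 13 311121)) (rd 7 2112133) (rd 4 3114)) (rd 0 2)
  (rd 7 312133)) (nd (nd (nd (nd no (rd 0 2) (rd 3 3111221)) (rd 3 211221) (rd 3 311221)) (rd 6
  2122133) (rd 10 31221)) (nd (rd 8 12221) no (rd 4 3222133)) (nd (nd (nd (nd no (rd 0 2) (rd 5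
  31114)) (rd 4 21134) (rd 4 3114)) (rd 0 2) (rd 4 3134)) (rd 0 2) (nd (rd 1 133) (rd 1 233) (nd (rd
  10 133322133) (rd 12 233322133) no)))) (rd 7 32133)) (rd 5 3133)) no (nd (rd 2 13111) (rd 2 23111)
  (nd (rd 2 133111) (rd 2 233111) (nd (nd (nd (nd no (rd 0 2) (rd 3 3111221)) (rd 3 211221) (rd 3
  311221)) (nd (rd 8 12122133) (nd (rd 10 1221) (nd (rd 8 12221) no (rd 12 32221)) (rd 6 3221221))
  (rd 5 321)) (rd 9 31221)) (nd (nd (nd (nd no (rd 0 2) (rd 5 31114)) (nd (rd 6 121134) (nd (rd 5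
  1221134) (nd (rd 6 12221134) no (rd 16 3222112333111)) (nd (rd 5 1313111) (rd 0 2) (nd (rd 9
  13322114) (rd 11 23322114) (nd (rd 5 133313111) (rd 5 233313111) no)))) (rd 3 32114)) (rd 4 3114))
  (rd 0 2) (rd 14 3123111)) (nd (rd 8 122333111) (nd (rd 5 1222) no (nd (rd 2 13111) (rd 2 23111) (nd
  (rd 2 133111) (rd 2 233111) (nd (rd 5 1333222) (rd 5 2333222) no)))) (nd (rd 5 1311) (rd 0 2) (nd
  (rd 1 133) (rd 1 233) (nd (rd 2 1333) (rd 2 2333) no)))) (rd 9 32333111)) no)))) (rd 0 3)) (rd 7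
  34)) (nd (nd (nd (nd no (rd 0 2) (rd 5 31114)) (nd (rd 14 12114) (nd (rd 13 122114) (nd (rd 12
  1222114) no (nd (rd 10 13222114) (rd 10 2311133) (nd (rd 9 133222114) (rd 12 233222114) (nd (rd 11
  1333222114) (rd 14 2333222114) no)))) (nd (rd 11 1322114) (rd 0 2) (nd (rd 9 13322114) (rd 11
  23322114) (nd (rd 10 133322114) (rd 13 233322114) no)))) (rd 3 32114)) (rd 4 3114)) (rd 0 2) (rd 6
  314)) (rd 0 2) (nd (nd (nd (nd no (rd 0 2) (nd (nd (nd (nd no (rd 0 2) (rd 2 31113111)) (rd 2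
  233111) (rd 2 3113111)) (rd 0 2) (nd (rd 5 1313111) (rd 0 2) (nd (rd 9 13322114) (rd 11 23322114)
  (nd (rd 5 133313111) (rd 5 233313111) no)))) (nd (nd (nd (nd no (rd 0 2) (rd 5 31114)) (rd 8
  21123111) (rd 4 3114)) (rd 0 2) (rd 8 3123111)) (nd (nd (nd (nd no (rd 0 2) (rd 7 3111223111)) (rd
  7 211223111) (rd 6 311)) (rd 4 21223111) (rd 4 31223111)) (nd (rd 5 1222) no (rd 8 32223111)) (nd
  (nd (nd (nd no (rd 0 2) (rd 5 31114)) (rd 5 211311) (rd 4 3114)) (rd 0 2) (rd 6 314)) (rd 0 2) (nd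
  (rd 1 133) (rd 1 233) (nd (rd 2 1333) (rd 2 2333) no)))) (rd 8 323111)) (nd (nd (nd (nd no (rd 0 2)
  (nd (rd 4 1311133) (rd 4 2311133) (nd (rd 4 13311133) (rd 4 23311133) (nd (rd 4 133311133) (rd 4
  233311133) no)))) (rd 1 233) (rd 1 31133)) (nd (rd 11 12133111) (nd (rd 7 122333) (nd (rd 8 12221)
  no (rd 4 3222133)) (nd (rd 4 134) (rd 0 2) (nd (rd 1 133) (rd 1 233) (nd (rd 4 13334) (rd 4 23334)
  no)))) (rd 8 32133)) (rd 12 3133111)) (nd (rd 7 121121) (nd (nd (nd (nd no (rd 0 2) (rd 6 3111333))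
  (nd (nd (nd (nd no (rd 0 2) (rd 4 3111211)) (rd 4 211211) (rd 4 311211)) (rd 0 2) (rd 4 31211)) (nd
  (rd 9 12211) (nd (rd 13 122211333) no (nd (rd 2 13111) (rd 2 23111) (nd (rd 2 133111) (rd 2 233111)
  (nd (rd 11 133322211333) (rd 13 233322211333) no)))) (rd 5 32211333)) (rd 11 3211)) (rd 8 311333))
  (rd 2 2333) (rd 2 31333)) (nd (rd 4 12221121) no (nd (rd 4 1311133) (rd 4 2311133) (nd (rd 4
  13311133) (rd 4 23311133) (nd (rd 4 133311133) (rd 4 233311133) no)))) (nd (rd 3 1314) (rd 0 2) (nd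
  (rd 3 13314) (rd 3 23314) (nd (rd 3 133314) (rd 3 233314) no)))) (rd 3 32114)) (nd (nd (nd (nd no
  (rd 0 2) (rd 3 3111221)) (rd 3 211221) (rd 3 311221)) (nd (rd 9 121223111) (nd (rd 10 1221) (nd (rd
  8 12221) no (rd 11 32221)) (rd 6 3221221)) (rd 5 321)) (rd 10 31221)) (nd (nd (nd (nd no (rd 0 2)
  (rd 5 31114)) (nd (rd 6 121134) (nd (rd 5 1221134) (nd (rd 6 12221134) no (rd 8 32221123111)) (nd
  (rd 5 1313111) (rd 0 2) (nd (rd 9 13322114) (rd 11 23322114) (nd (rd 5 133313111) (rd 5 233313111)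
  no)))) (rd 3 32114)) (rd 4 3114)) (rd 0 2) (rd 10 3123111)) (nd (nd (nd (nd no (rd 0 2) (rd 11
  3111223111)) (nd (rd 11 1211) (nd (rd 9 12211) (nd (rd 5 1222) no (rd 7 322211223111)) (rd 13
  32211)) (rd 10 3211)) (rd 6 311)) (rd 4 21223111) (rd 4 31223111)) (nd (rd 5 1222) no (rd 9
  32223111)) (nd (rd 5 1311) (rd 0 2) (nd (rd 1 133) (rd 1 233) (nd (rd 2 1333) (rd 2 2333) no))))
  (rd 12 323111)) no)))) (rd 1 233) (nd (rd 5 1311) (rd 0 2) (nd (rd 1 133) (rd 1 233) (nd (rd 2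
  1333) (rd 2 2333) no)))) (nd (nd (nd (nd no (rd 0 2) (rd 13 311121)) (nd (nd (nd (nd no (rd 0 2)
  (rd 10 31112114)) (rd 7 21121121) (rd 12 311211)) (rd 0 2) (rd 7 312114)) (nd (rd 5 1221134) (nd
  (rd 4 12221121) no (nd (rd 4 1311133) (rd 4 2311133) (nd (rd 4 13311133) (rd 4 23311133) (nd (rd 4
  133311133) (rd 4 233311133) no)))) (nd (rd 5 1313111) (rd 0 2) (nd (rd 9 13322114) (rd 11 23322114)
  (nd (rd 5 133313111) (rd 5 233313111) no)))) (rd 3 32114)) (rd 4 3114)) (rd 0 2) (nd (rd 3 1314)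
  (rd 0 2) (nd (rd 3 13314) (rd 3 23314) (nd (rd 3 133314) (rd 3 233314) no)))) (nd (nd (nd (nd no
  (rd 0 2) (rd 3 3111221)) (rd 3 211221) (rd 3 311221)) (nd (nd (nd (nd no (rd 0 2) (rd 5 311121))
  (rd 5 21121) (rd 4 3114)) (rd 0 2) (rd 5 3121)) (nd (rd 10 1221) (nd (rd 8 12221) no (rd 12 32221))
  (rd 6 3221221)) (rd 5 321)) (rd 10 31221)) (nd (rd 8 12221) no (nd (rd 2 13111) (rd 2 23111) (nd
  (rd 2 133111) (rd 2 233111) (nd (rd 3 1333111) (rd 3 2333111) no)))) (nd (nd (nd (nd no (rd 0 2)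
  (rd 5 31114)) (rd 4 21134) (rd 4 3114)) (rd 0 2) (rd 4 3134)) (rd 0 2) (nd (rd 1 133) (rd 1 233)
  (nd (nd (nd (nd no (rd 0 2) (rd 6 3111333)) (rd 10 2113334) (rd 8 311333)) (rd 2 2333) (rd 2
  31333)) (nd (nd (nd (nd no (rd 0 2) (rd 12 311121)) (rd 9 21123334) (rd 4 3114)) (rd 0 2) (rd 8
  312333)) (nd (rd 7 122333) (nd (rd 8 12221) no (rd 6 32223334)) (rd 10 3223334)) (rd 9 323334))
  no)))) (nd (rd 4 134) (rd 0 2) (nd (rd 1 133) (rd 1 233) (nd (rd 4 13334) (rd 4 23334) no)))) (nd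
  (nd (nd (nd no (rd 0 2) (rd 5 31114)) (nd (rd 14 12114) (nd (rd 13 122114) (nd (rd 12 1222114) no
  (nd (rd 10 13222114) (rd 10 2311133) (nd (rd 9 133222114) (rd 12 233222114) (nd (rd 11 1333222114)
  (rd 14 2333222114) no)))) (nd (rd 11 1322114) (rd 0 2) (nd (rd 9 13322114) (rd 11 23322114) (nd (rd
  10 133322114) (rd 13 233322114) no)))) (rd 3 32114)) (rd 4 3114)) (rd 0 2) (rd 6 314)) (rd 0 2) (nd
  (rd 1 133) (rd 1 233) (nd (rd 2 1333) (rd 2 2333) no)))) (nd (nd (nd (nd no (rd 0 2) (nd (rd 2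
  13111) (rd 2 23111) (nd (rd 2 133111) (rd 2 233111) (nd (rd 3 1333111) (rd 3 2333111) no)))) (nd
  (rd 10 1211211) (nd (rd 6 12233) (nd (rd 4 12221121) no (nd (rd 4 1311133) (rd 4 2311133) (nd (rd 4
  13311133) (rd 4 23311133) (nd (rd 4 133311133) (rd 4 233311133) no)))) (nd (rd 3 1314) (rd 0 2) (nd
  (rd 3 13314) (rd 3 23314) (nd (rd 3 133314) (rd 3 233314) no)))) (rd 3 32114)) (rd 11 311211)) (rd
  0 2) (nd (rd 3 1314) (rd 0 2) (nd (rd 3 13314) (rd 3 23314) (nd (rd 3 133314) (rd 3 233314) no))))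
  (nd (nd (nd (nd no (rd 0 2) (rd 6 3111333)) (nd (rd 7 12113334) (nd (rd 9 12211) (nd (rd 7
  1222113334) no (nd (rd 2 13111) (rd 2 23111) (nd (rd 2 133111) (rd 2 233111) (nd (rd 11
  133322211333) (rd 13 233322211333) no)))) (rd 5 32211333)) (rd 11 3211)) (rd 8 311333)) (rd 2 2333)
  (rd 2 31333)) (nd (nd (nd (nd no (rd 0 2) (rd 7 311133)) (rd 1 233) (rd 1 31133)) (nd (rd 15 12133)
  (nd (rd 14 122133) (nd (rd 8 12221) no (rd 4 3222133)) (nd (rd 12 1322133) (rd 0 2) (nd (rd 1 133)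
  (rd 1 233) (nd (rd 10 133322133) (rd 12 233322133) no)))) (rd 7 32133)) (rd 5 3133)) no (nd (rd 2
  13111) (rd 2 23111) (nd (rd 2 133111) (rd 2 233111) (nd (rd 3 1333111) (rd 3 2333111) no)))) (nd
  (rd 3 1314) (rd 0 2) (nd (rd 3 13314) (rd 3 23314) (nd (rd 3 133314) (rd 3 233314) no)))) (nd (rd 7
  13211) (rd 0 2) (nd (rd 1 133) (rd 1 233) (nd (rd 2 1333) (rd 2 2333) no)))) (nd (nd (nd (nd no (rd
  0 2) (nd (rd 2 13111) (rd 2 23111) (nd (rd 2 133111) (rd 2 233111) (nd (rd 3 1333111) (rd 3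
  2333111) no)))) (nd (nd (nd (nd no (rd 0 2) (rd 4 3111211)) (rd 4 211211) (rd 4 311211)) (rd 0 2)
  (rd 4 31211)) (nd (rd 9 12211) (nd (nd (nd (nd no (rd 0 2) (rd 5 3111222)) (rd 1 233) (rd 1 31133))
  (rd 5 21222) (rd 5 3133)) no (nd (rd 2 13111) (rd 2 23111) (nd (rd 2 133111) (rd 2 233111) (nd (nd
  (nd (nd no (rd 0 2) (rd 3 3111221)) (rd 3 211221) (rd 3 311221)) (rd 11 21333222) (rd 9 31221)) (nd
  (nd (nd (nd no (rd 0 2) (rd 5 31114)) (rd 10 2112333222) (rd 4 3114)) (rd 0 2) (rd 14 3123111)) (nd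
  (rd 8 122333111) (nd (rd 5 1222) no (rd 10 3222333222)) (rd 11 322333222)) (rd 9 32333111)) no))))
  (nd (rd 3 1314) (rd 0 2) (nd (rd 3 13314) (rd 3 23314) (nd (rd 3 133314) (rd 3 233314) no)))) (rd
  11 3211)) (nd (rd 5 1311) (rd 0 2) (nd (rd 1 133) (rd 1 233) (nd (rd 2 1333) (rd 2 2333) no)))) (rd
  2 2333) (nd (rd 6 131) (rd 0 2) (nd (rd 1 133) (rd 1 233) (nd (rd 2 1333) (rd 2 2333) no)))) (nd
  (nd (nd (nd no (rd 0 2) (rd 12 311121)) (nd (rd 7 121121) (nd (rd 5 1221134) (nd (rd 4 12221121) no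
  (nd (rd 4 1311133) (rd 4 2311133) (nd (rd 4 13311133) (rd 4 23311133) (nd (rd 4 133311133) (rd 4
  233311133) no)))) (nd (rd 5 1313111) (rd 0 2) (nd (rd 9 13322114) (rd 11 23322114) (nd (rd 5
  133313111) (rd 5 233313111) no)))) (rd 3 32114)) (rd 4 3114)) (rd 0 2) (nd (rd 3 1314) (rd 0 2) (nd
  (rd 3 13314) (rd 3 23314) (nd (rd 3 133314) (rd 3 233314) no)))) (nd (nd (nd (nd no (rd 0 2) (rd 3
  3111221)) (rd 3 211221) (rd 3 311221)) (nd (rd 8 12122133) (nd (rd 10 1221) (nd (rd 8 12221) no (rd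
  12 32221)) (rd 6 3221221)) (rd 5 321)) (rd 9 31221)) (nd (rd 8 12221) no (nd (rd 2 13111) (rd 2
  23111) (nd (rd 2 133111) (rd 2 233111) (nd (rd 3 1333111) (rd 3 2333111) no)))) (nd (rd 4 134) (rd
  0 2) (nd (rd 1 133) (rd 1 233) (nd (rd 4 13334) (rd 4 23334) no)))) (nd (rd 4 134) (rd 0 2) (nd (rd
  1 133) (rd 1 233) (nd (rd 4 13334) (rd 4 23334) no)))) no)))

open Tr in
/-- States ending in `4`. -/
def t4 : Tr :=
  nd (nd (nd (nd no (rd 0 2) (nd (rd 2 13111) (rd 2 23111) (nd (rd 2 133111) (rd 2 233111) (nd (rd 3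
  1333111) (rd 3 2333111) no)))) (nd (nd (nd (nd no (rd 0 2) (nd (rd 2 13111) (rd 2 23111) (nd (rd 2
  133111) (rd 2 233111) (nd (rd 3 1333111) (rd 3 2333111) no)))) (nd (rd 10 1211211) (nd (nd (nd (nd
  no (rd 0 2) (rd 6 3111333)) (rd 6 2112233) (rd 8 311333)) (rd 2 2333) (rd 2 31333)) (nd (rd 4
  12221121) no (nd (rd 4 1311133) (rd 4 2311133) (nd (rd 4 13311133) (rd 4 23311133) (nd (rd 4
  133311133) (rd 4 233311133) no)))) (nd (rd 3 1314) (rd 0 2) (nd (rd 3 13314) (rd 3 23314) (nd (rd 3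
  133314) (rd 3 233314) no)))) (rd 3 32114)) (rd 12 311211)) (rd 0 2) (nd (rd 3 1314) (rd 0 2) (nd
  (rd 3 13314) (rd 3 23314) (nd (rd 3 133314) (rd 3 233314) no)))) (nd (nd (nd (nd no (rd 0 2) (rd 6
  3111333)) (nd (rd 7 12113334) (nd (rd 9 12211) (nd (rd 7 1222113334) no (nd (rd 2 13111) (rd 2
  23111) (nd (rd 2 133111) (rd 2 233111) (nd (rd 11 133322211333) (rd 13 233322211333) no)))) (rd 5
  32211333)) (rd 11 3211)) (rd 9 311333)) (rd 2 2333) (rd 2 31333)) (nd (nd (nd (nd no (rd 0 2) (nd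
  (rd 4 1311133) (rd 4 2311133) (nd (rd 4 13311133) (rd 4 23311133) (nd (rd 4 133311133) (rd 4
  233311133) no)))) (rd 1 233) (rd 1 31133)) (nd (nd (nd (nd no (rd 0 2) (rd 13 311121)) (nd (rd 15
  12112133111) (nd (rd 5 1221134) (nd (rd 4 12221121) no (nd (rd 4 1311133) (rd 4 2311133) (nd (rd 4
  13311133) (rd 4 23311133) (nd (rd 4 133311133) (rd 4 233311133) no)))) (rd 7 322112133)) (rd 3
  32114)) (rd 4 3114)) (rd 0 2) (rd 11 312133)) (nd (rd 6 1221222) (nd (rd 8 12221) no (rd 4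
  3222133)) (nd (rd 6 13221222) (rd 0 2) (nd (rd 1 133) (rd 1 233) (nd (rd 10 133322133) (rd 12
  233322133) no)))) (rd 8 32133)) (rd 5 3133)) no (nd (nd (nd (nd no (rd 0 2) (rd 2 31113111)) (rd 2
  233111) (rd 2 3113111)) (rd 0 2) (rd 10 31311133)) (rd 10 2311133) (nd (nd (nd (nd no (rd 0 2) (rd
  9 31113311133)) (rd 1 233) (rd 1 31133)) (rd 9 213311133) (rd 12 3133111)) (nd (rd 7 121121) (nd
  (nd (nd (nd no (rd 0 2) (rd 6 3111333)) (rd 7 211223311133) (rd 8 311333)) (rd 2 2333) (rd 2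
  31333)) (nd (rd 4 12221121) no (rd 10 32223311133)) (nd (rd 3 1314) (rd 0 2) (nd (rd 3 13314) (rd 3
  23314) (nd (rd 3 133314) (rd 3 233314) no)))) (rd 3 32114)) (nd (nd (nd (nd no (rd 0 2) (rd 3
  3111221)) (rd 3 211221) (rd 3 311221)) (nd (rd 9 121223111) (nd (rd 10 1221) (nd (rd 8 12221) no
  (rd 11 32221)) (rd 6 3221221)) (rd 5 321)) (rd 10 31221)) (nd (rd 9 1233311133) (nd (nd (nd (nd no
  (rd 0 2) (rd 11 3111223111)) (nd (rd 11 1211) (nd (rd 9 12211) (nd (rd 5 1222) no (rd 7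
  322211223111)) (rd 13 32211)) (rd 10 3211)) (rd 6 311)) (rd 4 21223111) (rd 4 31223111)) (nd (rd 5
  1222) no (rd 9 32223111)) (nd (rd 5 1311) (rd 0 2) (nd (rd 1 133) (rd 1 233) (nd (rd 2 1333) (rd 2
  2333) no)))) (rd 12 323111)) no)))) (nd (nd (nd (nd no (rd 0 2) (rd 3 3111314)) (rd 3 211314) (rd 4
  3114)) (rd 0 2) (rd 3 31314)) (rd 0 2) (nd (nd (nd (nd no (rd 0 2) (rd 9 31113314)) (rd 1 233) (rd
  1 31133)) (rd 9 213314) (rd 5 3133)) (nd (nd (nd (nd no (rd 0 2) (rd 7 3111233)) (rd 8 21123314)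
  (rd 11 311211)) (rd 0 2) (rd 8 3123314)) (nd (rd 6 12233) (nd (nd (nd (nd no (rd 0 2) (rd 7
  311133)) (rd 1 233) (rd 1 31133)) (rd 6 212223314) (rd 5 3133)) no (nd (rd 2 13111) (rd 2 23111)
  (nd (rd 2 133111) (rd 2 233111) (nd (rd 3 1333111) (rd 3 2333111) no)))) (rd 9 3223314)) (rd 5
  323314)) (nd (nd (nd (nd no (rd 0 2) (rd 13 311133314)) (nd (rd 8 1211221) (nd (rd 9 12211) (nd (rd
  5 1222) no (nd (rd 2 13111) (rd 2 23111) (nd (rd 2 133111) (rd 2 233111) (nd (rd 5 1333222) (rd 5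
  2333222) no)))) (rd 5 32211333)) (rd 10 3211)) (rd 9 311333)) (rd 2 2333) (rd 2 31333)) (nd (rd 8
  1233314) (nd (nd (nd (nd no (rd 0 2) (rd 3 3111221)) (rd 3 211221) (rd 3 311221)) (nd (nd (nd (nd
  no (rd 0 2) (rd 5 311121)) (rd 5 21121) (rd 4 3114)) (rd 0 2) (rd 5 3121)) (nd (rd 10 1221) (nd (rd
  8 12221) no (rd 12 32221)) (rd 6 3221221)) (rd 5 321)) (rd 9 31221)) (nd (rd 8 12221) no (rd 4
  3222133)) (nd (rd 4 134) (rd 0 2) (nd (rd 1 133) (rd 1 233) (nd (rd 4 13334) (rd 4 23334) no))))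
  (rd 8 32133)) no)))) (nd (rd 7 13211) (rd 0 2) (nd (rd 1 133) (rd 1 233) (nd (rd 2 1333) (rd 2
  2333) no)))) (nd (nd (nd (nd no (rd 0 2) (rd 5 31114)) (nd (rd 14 12114) (nd (rd 13 122114) (nd (rd
  12 1222114) no (nd (rd 10 13222114) (rd 10 2311133) (nd (rd 9 133222114) (rd 12 233222114) (nd (rd
  11 1333222114) (rd 14 2333222114) no)))) (nd (rd 11 1322114) (rd 0 2) (nd (rd 9 13322114) (rd 11
  23322114) (nd (rd 10 133322114) (rd 13 233322114) no)))) (rd 3 32114)) (rd 4 3114)) (rd 0 2) (rd 6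
  314)) (rd 0 2) (nd (rd 1 133) (rd 1 233) (nd (rd 2 1333) (rd 2 2333) no)))) (rd 0 2) (nd (nd (nd
  (nd no (rd 0 2) (nd (rd 2 13111) (rd 2 23111) (nd (rd 2 133111) (rd 2 233111) (nd (rd 3 1333111)
  (rd 3 2333111) no)))) (nd (nd (nd (nd no (rd 0 2) (rd 10 31112114)) (nd (rd 10 1211211) (nd (nd (nd
  (nd no (rd 0 2) (rd 6 3111333)) (rd 6 2112233) (rd 8 311333)) (rd 2 2333) (rd 2 31333)) (nd (rd 4
  12221121) no (rd 6 3222112114)) (nd (rd 3 1314) (rd 0 2) (nd (rd 3 13314) (rd 3 23314) (nd (rd 3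
  133314) (rd 3 233314) no)))) (rd 3 32114)) (rd 12 311211)) (rd 0 2) (rd 7 312114)) (nd (rd 5
  1221134) (nd (rd 4 12221121) no (nd (rd 4 1311133) (rd 4 2311133) (nd (rd 4 13311133) (rd 4
  23311133) (nd (rd 4 133311133) (rd 4 233311133) no)))) (nd (rd 5 1313111) (rd 0 2) (nd (rd 9
  13322114) (rd 11 23322114) (nd (rd 5 133313111) (rd 5 233313111) no)))) (rd 3 32114)) (rd 4 3114))
  (rd 0 2) (nd (rd 3 1314) (rd 0 2) (nd (rd 3 13314) (rd 3 23314) (nd (rd 3 133314) (rd 3 233314)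
  no)))) (rd 0 2) (nd (nd (nd (nd no (rd 0 2) (nd (rd 4 1311133) (rd 4 2311133) (nd (rd 4 13311133)
  (rd 4 23311133) (nd (rd 4 133311133) (rd 4 233311133) no)))) (rd 1 233) (rd 1 31133)) (nd (rd 7
  121222) (nd (rd 6 1221222) (nd (rd 8 12221) no (rd 4 3222133)) (nd (rd 6 13221222) (rd 0 2) (nd (rd
  1 133) (rd 1 233) (nd (rd 10 133322133) (rd 12 233322133) no)))) (rd 7 32133)) (rd 5 3133)) (nd (nd
  (nd (nd no (rd 0 2) (rd 7 3111233)) (nd (rd 10 1211211) (nd (rd 6 12233) (nd (rd 4 12221121) no (rd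
  14 322211233)) (nd (rd 3 1314) (rd 0 2) (nd (rd 3 13314) (rd 3 23314) (nd (rd 3 133314) (rd 3
  233314) no)))) (rd 3 32114)) (rd 11 311211)) (rd 0 2) (nd (rd 3 1314) (rd 0 2) (nd (rd 3 13314) (rd
  3 23314) (nd (rd 3 133314) (rd 3 233314) no)))) (nd (rd 6 12233) (nd (nd (nd (nd no (rd 0 2) (rd 7
  311133)) (rd 1 233) (rd 1 31133)) (nd (rd 7 121222) (nd (nd (nd (nd no (rd 0 2) (rd 3 3111221)) (rd
  3 211221) (rd 3 311221)) (rd 6 2122133) (rd 10 31221)) (nd (rd 8 12221) no (rd 4 3222133)) (nd (rd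
  12 1322133) (rd 0 2) (nd (rd 1 133) (rd 1 233) (nd (rd 10 133322133) (rd 12 233322133) no)))) (rd 7
  32133)) (rd 5 3133)) no (nd (rd 2 13111) (rd 2 23111) (nd (rd 2 133111) (rd 2 233111) (nd (rd 3
  1333111) (rd 3 2333111) no)))) (nd (rd 3 1314) (rd 0 2) (nd (rd 3 13314) (rd 3 23314) (nd (rd 3
  133314) (rd 3 233314) no)))) (nd (rd 7 13211) (rd 0 2) (nd (rd 1 133) (rd 1 233) (nd (rd 2 1333)
  (rd 2 2333) no)))) (nd (nd (nd (nd no (rd 0 2) (nd (rd 2 13111) (rd 2 23111) (nd (rd 2 133111) (rd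
  2 233111) (nd (rd 3 1333111) (rd 3 2333111) no)))) (nd (rd 8 1211221) (nd (rd 9 12211) (nd (rd 5
  1222) no (nd (rd 2 13111) (rd 2 23111) (nd (rd 2 133111) (rd 2 233111) (nd (rd 5 1333222) (rd 5
  2333222) no)))) (rd 5 32211333)) (rd 10 3211)) (rd 9 311333)) (rd 2 2333) (rd 2 31333)) (nd (nd (nd
  (nd no (rd 0 2) (rd 13 311121)) (nd (rd 9 12112133) (nd (rd 5 1221134) (nd (rd 4 12221121) no (nd
  (rd 4 1311133) (rd 4 2311133) (nd (rd 4 13311133) (rd 4 23311133) (nd (rd 4 133311133) (rd 4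
  233311133) no)))) (rd 7 322112133)) (rd 3 32114)) (rd 4 3114)) (rd 0 2) (rd 11 312133)) (nd (nd (nd
  (nd no (rd 0 2) (rd 3 3111221)) (rd 3 211221) (rd 3 311221)) (nd (rd 16 121221) (nd (rd 10 1221)
  (nd (rd 8 12221) no (rd 12 32221)) (rd 6 3221221)) (rd 5 321)) (rd 9 31221)) (nd (rd 8 12221) no
  (rd 4 3222133)) (nd (rd 4 134) (rd 0 2) (nd (rd 1 133) (rd 1 233) (nd (rd 4 13334) (rd 4 23334)
  no)))) (rd 8 32133)) no)))) (rd 1 2) (nd (nd (nd (nd no (rd 0 2) (rd 5 31114)) (nd (nd (nd (nd no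
  (rd 0 2) (rd 6 31112114)) (rd 6 2112114) (rd 12 311211)) (rd 0 2) (rd 6 312114)) (nd (nd (nd (nd no
  (rd 0 2) (rd 6 3111333)) (rd 5 21122114) (rd 9 311333)) (rd 2 2333) (rd 2 31333)) (nd (nd (nd (nd
  no (rd 0 2) (rd 4 3111222114)) (rd 1 233) (rd 1 31133)) (rd 4 21222114) (rd 5 3133)) no (nd (rd 10
  13222114) (rd 10 2311133) (nd (rd 9 133222114) (rd 12 233222114) (nd (nd (nd (nd no (rd 0 2) (rd 3
  3111221)) (rd 3 211221) (rd 3 311221)) (rd 11 21333222114) (rd 10 31221)) (nd (rd 9 1233311133) (nd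
  (nd (nd (nd no (rd 0 2) (rd 11 3111223111)) (rd 9 21122333222114) (rd 6 311)) (rd 4 21223111) (rd 4
  31223111)) (nd (rd 5 1222) no (rd 9 32223111)) (nd (rd 5 1311) (rd 0 2) (nd (rd 1 133) (rd 1 233)
  (nd (rd 2 1333) (rd 2 2333) no)))) (rd 12 323111)) no)))) (nd (rd 5 1313111) (rd 0 2) (nd (rd 9
  13322114) (rd 11 23322114) (nd (rd 5 133313111) (rd 5 233313111) no)))) (rd 3 32114)) (rd 4 3114))
  (rd 0 2) (nd (rd 3 1314) (rd 0 2) (nd (rd 3 13314) (rd 3 23314) (nd (rd 3 133314) (rd 3 233314)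
  no)))) (rd 0 2) (nd (rd 1 133) (rd 1 233) (nd (nd (nd (nd no (rd 0 2) (rd 6 3111333)) (nd (nd (nd
  (nd no (rd 0 2) (rd 4 3111211)) (rd 4 211211) (rd 4 311211)) (rd 0 2) (rd 4 31211)) (nd (rd 9
  12211) (nd (nd (nd (nd no (rd 0 2) (rd 5 3111222)) (rd 1 233) (rd 1 31133)) (rd 5 21222) (rd 5
  3133)) no (nd (rd 2 13111) (rd 2 23111) (nd (rd 2 133111) (rd 2 233111) (nd (rd 11 133322211333)
  (rd 13 233322211333) no)))) (rd 5 32211333)) (rd 11 3211)) (rd 8 311333)) (rd 2 2333) (rd 2 31333))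
  (nd (nd (nd (nd no (rd 0 2) (rd 12 311121)) (nd (rd 7 121121) (nd (rd 5 1221134) (nd (rd 4
  12221121) no (nd (rd 4 1311133) (rd 4 2311133) (nd (rd 4 13311133) (rd 4 23311133) (nd (rd 4
  133311133) (rd 4 233311133) no)))) (rd 15 322112333)) (rd 3 32114)) (rd 4 3114)) (rd 0 2) (rd 8
  312333)) (nd (rd 7 122333) (nd (rd 8 12221) no (nd (rd 2 13111) (rd 2 23111) (nd (rd 2 133111) (rd
  2 233111) (nd (rd 3 1333111) (rd 3 2333111) no)))) (nd (rd 4 134) (rd 0 2) (nd (rd 1 133) (rd 1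
  233) (nd (rd 4 13334) (rd 4 23334) no)))) (nd (rd 4 134) (rd 0 2) (nd (rd 1 133) (rd 1 233) (nd (rd
  4 13334) (rd 4 23334) no)))) no)))

noncomputable def child (a : ℕ) (t : Tr) : Tr :=
  Tr.rec Tr.no (fun _ _ => Tr.no) (fun x y z _ _ _ =>
    Bool.rec (Bool.rec (Bool.rec Tr.no z (Nat.beq a 3)) y (Nat.beq a 2)) x (Nat.beq a 1)) t

/-- The tree at a given word. -/
noncomputable def stt (w : List ℕ) : Tr :=
  List.rec t0 (fun a t r => List.rec (Bool.rec (child a r) t4 (Nat.beq a 4))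
    (fun _ _ _ => child a r) t) w

noncomputable def isNd (t : Tr) : Bool := Tr.rec false (fun _ _ => false) (fun _ _ _ _ _ _ => true) t

/-- Same first letter and same length of the first run. -/
noncomputable def sameLead (A B : List ℕ) : Bool :=
  List.rec false (fun a A' _ => List.rec false (fun b B' _ =>
    Bool.rec false (Nat.beq (lead a A') (lead a B')) (Nat.beq a b)) B) A

noncomputable def chkRule (t : ℕ) (w s : List ℕ) : Bool :=
  Bool.rec false (Bool.rec false (Bool.rec false (pchk t w s) (isNd (stt s))) (sameLead w s)) (r3 s)

noncomputable def chk (t : Tr) : List ℕ → Bool :=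
  Tr.rec (fun w => List.rec false (fun a w _ => Nat.ble 3 (lead a w)) w)
    (fun t s w => chkRule t w (dec s))
    (fun _ _ _ cx cy cz w =>
      Bool.rec false (Bool.rec false (Bool.rec false (cz (3 :: w)) (cy (2 :: w))) (cx (1 :: w)))
        (good 24 w)) t

set_option maxRecDepth 100000 in
theorem chk_t4 : chk t4 [4] = true := by decide +kernel

set_option maxRecDepth 100000 in
theorem chk_t0 : chk t0 [] = true := by decide +kernel

/-- Every element decays into elements. -/
theorem ebt_closed :
    (ebt.toL.all fun n => (atoms (C (dec n))).all isE) = true := by decide +kernel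


/-! ### Basic equations -/

theorem C_nil : C [] = [] := rfl
theorem C_cons (a : ℕ) (x : List ℕ) : C (a :: x) = push a (C x) := rfl
theorem lead_nil (z : ℕ) : lead z [] = 0 := rfl
theorem drp_nil (z : ℕ) : drp z [] = [] := rfl

theorem beq_eq (a b : ℕ) : Nat.beq a b = decide (a = b) := by
  by_cases h : a = b
  · subst h; simp
  · rw [decide_eq_false h, ← Bool.not_eq_true, Nat.beq_eq]; exact h

theorem rec_ite {α : Sort*} (p : Prop) [Decidable p] (x y : α) :
    @Bool.rec (fun _ => α) x y (decide p) = if p then y else x := by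
  by_cases h : p <;> simp [h]

theorem rec_false_iff (p q : Bool) :
    @Bool.rec (fun _ => Bool) false p q = true ↔ q = true ∧ p = true := by
  cases q <;> simp

theorem lead_cons (z a : ℕ) (x : List ℕ) :
    lead z (a :: x) = if z = a then lead z x + 1 else 0 := by
  rw [← rec_ite, ← beq_eq]; rfl

theorem drp_cons (z a : ℕ) (x : List ℕ) :
    drp z (a :: x) = if z = a then drp z x else a :: x := by
  rw [← rec_ite, ← beq_eq]; rfl

theorem push_nil (a : ℕ) : push a [] = [1, a] := rfl

theorem push_cons (a k b : ℕ) (r : List ℕ) :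
    push a (k :: b :: r) = if a = b then (k + 1) :: b :: r else 1 :: a :: k :: b :: r := by
  rw [← rec_ite, ← beq_eq]; rfl

theorem C_run (a : ℕ) (x : List ℕ) : C (a :: x) = (lead a x + 1) :: a :: C (drp a x) := by
  induction x generalizing a with
  | nil => rfl
  | cons b t ih =>
    rw [C_cons, ih b, push_cons, lead_cons, drp_cons]
    split_ifs with h
    · subst h; rfl
    · simp [ih b]

theorem drp_head (z : ℕ) (x : List ℕ) : ∀ b ∈ (drp z x).head?, z ≠ b := by
  induction x with
  | nil => simp [drp_nil]
  | cons a t ih =>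
    rw [drp_cons]
    split_ifs with h
    · exact ih
    · simpa using h

theorem lead_drp (z : ℕ) (x : List ℕ) : x = List.replicate (lead z x) z ++ drp z x := by
  induction x with
  | nil => rfl
  | cons a t ih =>
    rw [drp_cons, lead_cons]
    split_ifs with h
    · subst h; rw [List.replicate_succ, List.cons_append, ← ih]
    · rfl

theorem drp_length (z : ℕ) (x : List ℕ) : (drp z x).length ≤ x.length := by
  conv_rhs => rw [lead_drp z x]
  simp

theorem C_append (u v : List ℕ) (h : ∀ a ∈ u.getLast?, ∀ b ∈ v.head?, a ≠ b) :
    C (u ++ v) = C u ++ C v := by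
  induction u with
  | nil => rfl
  | cons a u ih =>
    cases u with
    | nil =>
      cases v with
      | nil => rfl
      | cons b v =>
        have hab : a ≠ b := by simpa using h
        rw [List.cons_append, List.nil_append, C_cons, C_run b v, push_cons, if_neg hab]
        rfl
    | cons a' u =>
      rw [List.cons_append, C_cons, ih (by simpa using h), C_cons a, C_run a' u]
      simp only [List.cons_append, push_cons]
      split_ifs <;> rfl

theorem C_last (u : List ℕ) : (C u).getLast? = u.getLast? := by
  induction u with
  | nil => rfl
  | cons a u ih =>
    cases u with
    | nil => rfl
    | cons b u =>
      rw [C_cons]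
      rw [C_run] at ih ⊢
      rw [push_cons]
      split_ifs with h <;> simp_all [List.getLast?_cons_cons]

theorem C_ne_nil {x : List ℕ} (h : x ≠ []) : C x ≠ [] := by
  cases x with
  | nil => exact absurd rfl h
  | cons a x => rw [C_run]; simp

theorem r3_cons (a : ℕ) (x : List ℕ) : r3 (a :: x) = true ↔ lead a x ≤ 2 ∧ r3 x = true := by
  change Bool.rec false (r3 x) (Nat.ble (lead a x) 2) = true ↔ _
  rw [rec_false_iff, Nat.ble_eq]

theorem r3_C_aux (x : List ℕ) : r3 (C x) = true ∧
    ∀ a ∈ x.head?, lead a (C x).tail.tail ≤ 1 := by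
  induction x with
  | nil => exact ⟨rfl, by simp⟩
  | cons a x ih =>
    cases x with
    | nil =>
      refine ⟨?_, by simp [C_cons, push_nil, C_nil, lead_nil]⟩
      simp only [C_cons, C_nil, push_nil, r3_cons, lead_cons, lead_nil]
      refine ⟨by split_ifs <;> simp, by simp, rfl⟩
    | cons b t =>
      rw [C_cons]
      rw [C_run] at ih ⊢
      simp only [List.tail_cons, List.head?_cons, Option.mem_def, Option.some.injEq,
        forall_eq'] at ih ⊢
      obtain ⟨h1, h2⟩ := ih
      rw [push_cons]
      rw [r3_cons, r3_cons, lead_cons] at h1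
      split_ifs with h
      · subst h
        simp only [List.tail_cons]
        refine ⟨?_, h2⟩
        rw [r3_cons, r3_cons, lead_cons]
        refine ⟨?_, h1.2⟩
        split_ifs with h3
        · rw [h3]; omega
        · omega
      · simp only [List.tail_cons]
        have h4 : lead a ((lead b t + 1) :: b :: C (drp b t)) ≤ 1 := by
          rw [lead_cons, lead_cons, if_neg h]; split_ifs <;> omega
        refine ⟨?_, h4⟩
        rw [r3_cons, r3_cons, r3_cons, r3_cons, lead_cons 1, lead_cons (lead b t + 1)]
        refine ⟨?_, by omega, h1⟩
        split_ifs with h5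
        · subst h5; omega
        · omega

theorem r3_C (x : List ℕ) : r3 (C x) = true := (r3_C_aux x).1

theorem r3_tail {a : ℕ} {x : List ℕ} (h : r3 (a :: x) = true) : r3 x = true :=
  ((r3_cons a x).1 h).2

theorem r3_suffix (u v : List ℕ) (h : r3 (u ++ v) = true) : r3 v = true := by
  induction u with
  | nil => exact h
  | cons a u ih => exact ih (r3_tail h)

theorem lead_append_congr {A B : List ℕ} (h : ∀ z, lead z A = lead z B) (l : List ℕ) (z : ℕ) :
    lead z (l ++ A) = lead z (l ++ B) := by
  induction l with
  | nil => exact h z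
  | cons a l ih => simp only [List.cons_append, lead_cons, ih]

theorem r3_append_congr {A B : List ℕ} (h : ∀ z, lead z A = lead z B) (hB : r3 B = true)
    (l : List ℕ) (hA : r3 (l ++ A) = true) : r3 (l ++ B) = true := by
  induction l with
  | nil => exact hB
  | cons a l ih =>
    rw [List.cons_append, r3_cons] at hA ⊢
    exact ⟨by rw [← lead_append_congr h]; exact hA.1, ih hA.2⟩

theorem lead_prefix (a : ℕ) (u v : List ℕ) : lead a u ≤ lead a (u ++ v) := by
  induction u with
  | nil => simp [lead_nil]
  | cons b u ih => simp only [List.cons_append, lead_cons]; split_ifs <;> omega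

theorem r3_prefix (u v : List ℕ) (h : r3 (u ++ v) = true) : r3 u = true := by
  induction u with
  | nil => rfl
  | cons a u ih =>
    rw [List.cons_append, r3_cons] at h
    exact (r3_cons a u).2 ⟨(lead_prefix a u v).trans h.1, ih h.2⟩

/-! ### The splitting criterion -/

theorem hdne_nil (z : ℕ) : hdne z [] = true := rfl
theorem hdne_cons (z c : ℕ) (t : List ℕ) : hdne z (c :: t) = true ↔ c ≠ z := by
  change Bool.rec true false (Nat.beq c z) = true ↔ _
  rw [beq_eq, rec_ite]; split_ifs with h <;> simp [h]

theorem st1_cons (b : ℕ) (t : List ℕ) : st1 (b :: t) = true ↔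
    (b ≠ 1 ∧ hdne b t = true) ∨ (b = 1 ∧ ∃ u, t = 1 :: u ∧ hdne 1 u = true) := by
  change Bool.rec (hdne b t) (List.rec false (fun c u _ => Bool.rec false (hdne 1 u) (Nat.beq c 1)) t)
    (Nat.beq b 1) = true ↔ _
  rw [beq_eq, rec_ite]
  split_ifs with h
  · subst h
    cases t with
    | nil => simp
    | cons c u =>
      change Bool.rec false (hdne 1 u) (Nat.beq c 1) = true ↔ _
      rw [rec_false_iff]
      simp
  · simp [h]

theorem st3_cons (b : ℕ) (t : List ℕ) : st3 (b :: t) = true ↔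
    b ≠ 3 ∧ (∀ u, t = b :: u → hdne b u = true) := by
  change Bool.rec (List.rec true (fun c u _ => Bool.rec true (hdne b u) (Nat.beq c b)) t) false
    (Nat.beq b 3) = true ↔ _
  rw [beq_eq, rec_ite]
  split_ifs with h
  · simp [h]
  · cases t with
    | nil => simp [h]
    | cons c u =>
      change Bool.rec true (hdne b u) (Nat.beq c b) = true ↔ _
      rw [beq_eq, rec_ite]
      split_ifs with h2
      · subst h2; simp [h]
      · simp [h, h2]

theorem stA_nil : stA [] = false := rfl
theorem stA_cons (a : ℕ) (t : List ℕ) : stA (a :: t) = true ↔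
    (a = 1 ∧ st1 t = true) ∨ (a = 3 ∧ st3 t = true) := by
  change Bool.rec (Bool.rec false (st3 t) (Nat.beq a 3)) (st1 t) (Nat.beq a 1) = true ↔ _
  rw [beq_eq, beq_eq, rec_ite, rec_ite]
  split_ifs with h h2
  · subst h; simp
  · subst h2; simp
  · simp [h, h2]

theorem stB_iff (v : List ℕ) : stB v = true ↔
    ∃ w, v = 2 :: 2 :: w ∧ (w = [] ∨ stA w = true) := by
  cases v with
  | nil => simp; rfl
  | cons a v =>
    change Bool.rec false (stB1 v) (Nat.beq a 2) = true ↔ _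
    rw [rec_false_iff]
    cases v with
    | nil =>
      simp; intro; rfl
    | cons b v =>
      change _ ∧ Bool.rec false (stB2 v) (Nat.beq b 2) = true ↔ _
      rw [rec_false_iff]
      have : stB2 v = true ↔ v = [] ∨ stA v = true := by
        cases v with
        | nil => simp; rfl
        | cons c v => simp; rfl
      rw [this]
      simp [and_assoc]

theorem sp_iff (a : ℕ) (v : List ℕ) : sp a v = true ↔
    (a = 2 ∧ stA v = true) ∨ (a ≠ 2 ∧ stB v = true) := by
  change Bool.rec (stB v) (stA v) (Nat.beq a 2) = true ↔ _
  rw [beq_eq, rec_ite]; split_ifs with h <;> simp [h]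

theorem stA_ne_nil {v : List ℕ} (h : stA v = true) : v ≠ [] := by
  rintro rfl; simp [stA_nil] at h

theorem stA_head {v : List ℕ} (h : stA v = true) : ∀ b ∈ v.head?, b ≠ 2 := by
  cases v with
  | nil => simp
  | cons a t =>
    rw [stA_cons] at h
    simp only [List.head?_cons, Option.mem_def, Option.some.injEq, forall_eq']
    omega

theorem hdne_iff (z : ℕ) (v : List ℕ) : hdne z v = true ↔ ∀ b ∈ v.head?, b ≠ z := by
  cases v with
  | nil => simp [hdne_nil]
  | cons a t => simp [hdne_cons]

theorem lead_zero {z : ℕ} {v : List ℕ} (h : hdne z v = true) : lead z v = 0 := by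
  cases v with
  | nil => rfl
  | cons a t => rw [hdne_cons] at h; rw [lead_cons, if_neg (Ne.symm h)]

theorem drp_self {z : ℕ} {v : List ℕ} (h : hdne z v = true) : drp z v = v := by
  cases v with
  | nil => rfl
  | cons a t => rw [hdne_cons] at h; rw [drp_cons, if_neg (Ne.symm h)]

theorem stA_C {v : List ℕ} (h : stA v = true) : stA (C v) = true := by
  cases v with
  | nil => simp [stA_nil] at h
  | cons a t =>
    rw [stA_cons] at h
    rcases h with ⟨rfl, h⟩ | ⟨rfl, h⟩
    · cases t with
      | nil => exact absurd h (by decide +kernel)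
      | cons b t =>
        rw [st1_cons] at h
        rcases h with ⟨hb, h⟩ | ⟨rfl, u, rfl, h⟩
        · rw [C_run, lead_cons, drp_cons, if_neg (Ne.symm hb), if_neg (Ne.symm hb), C_run,
            lead_zero h, stA_cons, st1_cons]
          left
          refine ⟨rfl, Or.inr ⟨rfl, _, rfl, ?_⟩⟩
          rw [hdne_cons]; exact hb
        · rw [C_run]
          simp only [lead_cons, drp_cons, if_true, lead_zero h, drp_self h]
          rw [stA_cons]
          right
          refine ⟨rfl, ?_⟩
          rw [st3_cons]
          refine ⟨by decide, ?_⟩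
          intro w hw
          cases u with
          | nil => simp [C_nil] at hw
          | cons c u =>
            rw [C_run] at hw
            obtain ⟨-, rfl⟩ := List.cons_eq_cons.1 hw
            rw [hdne_cons] at h ⊢
            exact h
    · cases t with
      | nil => decide +kernel
      | cons b t =>
        rw [st3_cons] at h
        obtain ⟨hb, h⟩ := h
        rw [C_run, lead_cons, drp_cons, if_neg (Ne.symm hb), if_neg (Ne.symm hb), C_run,
            stA_cons, st1_cons]
        left
        refine ⟨rfl, Or.inl ⟨by decide, ?_⟩⟩
        rw [hdne_cons]
        cases t with
        | nil => simp [lead_nil]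
        | cons c u =>
          rw [lead_cons]
          split_ifs with hc
          · subst hc
            rw [lead_zero (h u rfl)]; decide
          · decide

theorem stB_C {v : List ℕ} (h : stB v = true) : stB (C v) = true := by
  rw [stB_iff] at h ⊢
  obtain ⟨w, rfl, h⟩ := h
  have hw : hdne 2 w = true := by
    rcases h with rfl | h
    · rfl
    · rw [hdne_iff]; exact stA_head h
  refine ⟨C w, ?_, ?_⟩
  · rw [C_run]; simp [lead_cons, drp_cons, lead_zero hw, drp_self hw]
  · rcases h with rfl | h
    · left; rfl
    · right; exact stA_C h

theorem sp_C {a : ℕ} {v : List ℕ} (h : sp a v = true) : sp a (C v) = true := by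
  rw [sp_iff] at h ⊢
  rcases h with ⟨h1, h2⟩ | ⟨h1, h2⟩
  · exact Or.inl ⟨h1, stA_C h2⟩
  · exact Or.inr ⟨h1, stB_C h2⟩

theorem sp_head {a : ℕ} {v : List ℕ} (h : sp a v = true) : ∀ b ∈ v.head?, a ≠ b := by
  rw [sp_iff] at h
  rcases h with ⟨rfl, h2⟩ | ⟨h1, h2⟩
  · intro b hb; exact (stA_head h2 b hb).symm
  · rw [stB_iff] at h2
    obtain ⟨w, rfl, -⟩ := h2
    simpa using h1

/-- The word `u` splits from the word `v`. -/
def splits (u v : List ℕ) : Prop := ∃ a, u.getLast? = some a ∧ sp a v = true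

theorem splits_C {u v : List ℕ} (h : splits u v) :
    C (u ++ v) = C u ++ C v ∧ splits (C u) (C v) := by
  obtain ⟨a, h1, h2⟩ := h
  refine ⟨C_append u v ?_, a, by rw [C_last, h1], sp_C h2⟩
  intro a' ha'
  rw [h1] at ha'
  obtain rfl : a = a' := by simpa using ha'
  exact sp_head h2

theorem splits_iter {u v : List ℕ} (h : splits u v) (n : ℕ) :
    C^[n] (u ++ v) = C^[n] u ++ C^[n] v ∧ splits (C^[n] u) (C^[n] v) := by
  induction n with
  | zero => exact ⟨rfl, h⟩
  | succ n ih =>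
    simp only [Function.iterate_succ_apply', ih.1]
    exact splits_C ih.2


/-! ### Atoms -/

theorem splits_cons {a b : ℕ} {u v : List ℕ} : splits (a :: b :: u) v ↔ splits (b :: u) v := by
  simp [splits, List.getLast?_cons_cons]

theorem splits_single {a : ℕ} {v : List ℕ} : splits [a] v ↔ sp a v = true := by
  simp [splits]

theorem splits_append {u₁ u₂ v : List ℕ} (h : splits u₂ v) : splits (u₁ ++ u₂) v := by
  obtain ⟨a, h1, h2⟩ := h
  exact ⟨a, by simp [List.getLast?_append, h1], h2⟩

theorem splits_ne_nil {u v : List ℕ} (h : splits u v) : u ≠ [] := by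
  rintro rfl; obtain ⟨a, h1, -⟩ := h; simp at h1

theorem sp_hdne {a : ℕ} {v : List ℕ} (h : sp a v = true) : hdne a v = true := by
  rw [hdne_iff]; intro b hb; exact (sp_head h b hb).symm

theorem sp_ne2 {a : ℕ} {v : List ℕ} (h : sp a v = true) (ha : a ≠ 2) :
    ∃ w, v = 2 :: 2 :: w ∧ (w = [] ∨ stA w = true) := by
  rw [sp_iff] at h
  rcases h with ⟨h1, -⟩ | ⟨-, h⟩
  · exact absurd h1 ha
  · exact (stB_iff v).1 h

theorem st1_append {u v : List ℕ} (h : splits u v) : st1 (u ++ v) = true ↔ st1 u = true := by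
  match u with
  | [] => exact absurd rfl (splits_ne_nil h)
  | [b] =>
    rw [splits_single] at h
    simp only [List.cons_append, List.nil_append, st1_cons, hdne_nil, sp_hdne h]
    constructor
    · rintro (h1 | ⟨rfl, u, rfl, -⟩)
      · exact Or.inl h1
      · obtain ⟨w, hw, -⟩ := sp_ne2 h (by decide)
        simp at hw
    · rintro (h1 | ⟨rfl, u, hu, -⟩)
      · exact Or.inl h1
      · simp at hu
  | b :: c :: u =>
    rw [splits_cons] at h
    simp only [List.cons_append, st1_cons, hdne_cons]
    refine or_congr Iff.rfl (and_congr Iff.rfl ?_)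
    simp only [List.cons.injEq]
    match u with
    | [] =>
      constructor
      · rintro ⟨w, ⟨rfl, rfl⟩, -⟩
        exact ⟨[], ⟨rfl, rfl⟩, rfl⟩
      · rintro ⟨w, ⟨rfl, rfl⟩, -⟩
        exact ⟨_, ⟨rfl, rfl⟩, sp_hdne (splits_single.1 h)⟩
    | d :: u =>
      constructor
      · rintro ⟨w, ⟨rfl, rfl⟩, h2⟩
        exact ⟨_, ⟨rfl, rfl⟩, by rw [List.cons_append, hdne_cons] at h2; rwa [hdne_cons]⟩
      · rintro ⟨w, ⟨rfl, rfl⟩, h2⟩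
        exact ⟨_, ⟨rfl, rfl⟩, by rw [hdne_cons] at h2; rwa [List.cons_append, hdne_cons]⟩

theorem st3_append {u v : List ℕ} (h : splits u v) : st3 (u ++ v) = true ↔ st3 u = true := by
  match u with
  | [] => exact absurd rfl (splits_ne_nil h)
  | [b] =>
    rw [splits_single] at h
    simp only [List.cons_append, List.nil_append, st3_cons]
    refine and_congr Iff.rfl ⟨fun _ u hu => by simp at hu, ?_⟩
    rintro - u rfl
    exact absurd rfl (sp_head h b rfl)
  | [b, c] =>
    rw [splits_cons, splits_single] at h
    simp only [List.cons_append, List.nil_append, st3_cons, List.cons.injEq]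
    refine and_congr Iff.rfl ⟨?_, ?_⟩
    · rintro - u ⟨rfl, rfl⟩; rfl
    · rintro - u ⟨rfl, rfl⟩; exact sp_hdne h
  | b :: c :: d :: u =>
    simp only [List.cons_append, st3_cons, List.cons.injEq]
    refine and_congr Iff.rfl ⟨?_, ?_⟩
    · rintro h u ⟨rfl, rfl⟩; rw [hdne_cons, ← hdne_cons]; exact h _ ⟨rfl, rfl⟩
    · rintro h u ⟨rfl, rfl⟩; rw [hdne_cons, ← hdne_cons]; exact h _ ⟨rfl, rfl⟩

theorem stA_append {u v : List ℕ} (h : splits u v) : stA (u ++ v) = true ↔ stA u = true := by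
  match u with
  | [] => exact absurd rfl (splits_ne_nil h)
  | [b] =>
    rw [splits_single] at h
    simp only [List.cons_append, List.nil_append, stA_cons]
    constructor
    · rintro (⟨rfl, h2⟩ | ⟨rfl, h2⟩)
      · obtain ⟨w, rfl, -⟩ := sp_ne2 h (by decide)
        rw [st1_cons, hdne_cons] at h2
        simp at h2
      · exact Or.inr ⟨rfl, rfl⟩
    · rintro (⟨rfl, h2⟩ | ⟨rfl, h2⟩)
      · exact absurd h2 (by decide +kernel)
      · right
        refine ⟨rfl, ?_⟩
        obtain ⟨w, rfl, hw⟩ := sp_ne2 h (by decide)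
        rw [st3_cons]
        refine ⟨by decide, ?_⟩
        rintro u ⟨⟩
        rcases hw with rfl | hw
        · rfl
        · rw [hdne_iff]; exact stA_head hw
  | b :: c :: u =>
    have h' := splits_cons.1 h
    rw [List.cons_append, stA_cons, stA_cons, st1_append h', st3_append h']

theorem stB_append {u v : List ℕ} (h : splits u v) : stB (u ++ v) = true ↔ stB u = true := by
  match u with
  | [] => exact absurd rfl (splits_ne_nil h)
  | [b] =>
    rw [splits_single] at h
    simp only [stB_iff, List.cons_append, List.nil_append, List.cons.injEq]
    constructor
    · rintro ⟨w, ⟨rfl, rfl⟩, -⟩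
      exact absurd rfl (sp_head h 2 rfl)
    · rintro ⟨w, ⟨rfl, hw⟩, -⟩
      simp at hw
  | [b, c] =>
    rw [splits_cons, splits_single] at h
    simp only [stB_iff, List.cons_append, List.nil_append, List.cons.injEq]
    constructor
    · rintro ⟨w, ⟨rfl, rfl, rfl⟩, -⟩
      exact ⟨[], ⟨rfl, rfl, rfl⟩, Or.inl rfl⟩
    · rintro ⟨w, ⟨rfl, rfl, rfl⟩, -⟩
      refine ⟨v, ⟨rfl, rfl, rfl⟩, Or.inr ?_⟩
      rw [sp_iff] at h
      rcases h with h | h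
      · exact h.2
      · exact absurd rfl h.1
  | b :: c :: d :: u =>
    have h' := splits_cons.1 (splits_cons.1 h)
    simp only [stB_iff, List.cons_append, List.cons.injEq]
    constructor
    · rintro ⟨w, ⟨rfl, rfl, rfl⟩, hw⟩
      refine ⟨_, ⟨rfl, rfl, rfl⟩, ?_⟩
      rw [← List.cons_append, stA_append h'] at hw
      simpa using hw
    · rintro ⟨w, ⟨rfl, rfl, rfl⟩, hw⟩
      refine ⟨_, ⟨rfl, rfl, rfl⟩, ?_⟩
      rw [← List.cons_append, stA_append h']
      simpa using hw

theorem sp_append {u v : List ℕ} (h : splits u v) (a : ℕ) : sp a (u ++ v) = sp a u := by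
  rw [Bool.eq_iff_iff, sp_iff, sp_iff, stA_append h, stB_append h]

theorem atoms_nil : atoms [] = [] := rfl

theorem atoms_cons (a : ℕ) (t : List ℕ) :
    atoms (a :: t) = if sp a t = true then [a] :: atoms t else consHead a (atoms t) := by
  change @Bool.rec (fun _ => List (List ℕ)) (consHead a (atoms t)) ([a] :: atoms t) (sp a t) = _
  cases sp a t <;> simp

theorem consHead_cons (a : ℕ) (b : List ℕ) (bs : List (List ℕ)) :
    consHead a (b :: bs) = (a :: b) :: bs := rfl

theorem atoms_ne_nil {x : List ℕ} (h : x ≠ []) : atoms x ≠ [] := by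
  cases x with
  | nil => exact absurd rfl h
  | cons a t =>
    rw [atoms_cons]
    split_ifs
    · simp
    · cases atoms t <;> simp [consHead]

theorem consHead_append (a : ℕ) {l : List (List ℕ)} (h : l ≠ []) (m : List (List ℕ)) :
    consHead a (l ++ m) = consHead a l ++ m := by
  cases l with
  | nil => exact absurd rfl h
  | cons b l => rfl

theorem atoms_append {u v : List ℕ} (h : splits u v) : atoms (u ++ v) = atoms u ++ atoms v := by
  induction u with
  | nil => rfl
  | cons a u ih =>
    cases u with
    | nil =>
      rw [splits_single] at h
      rw [List.cons_append, List.nil_append, atoms_cons, if_pos h]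
      rw [atoms_cons, if_neg (by rw [sp_iff, stB_iff, stA_nil]; simp : ¬ sp a [] = true)]
      rfl
    | cons b u =>
      have h' := splits_cons.1 h
      rw [List.cons_append, atoms_cons, sp_append h', atoms_cons a, ih h']
      split_ifs
      · rfl
      · rw [consHead_append _ (atoms_ne_nil (by simp))]

theorem atoms_struct (x : List ℕ) (hx : x ≠ []) : ∃ b rest, x = b ++ rest ∧
    atoms x = b :: atoms rest ∧ b ≠ [] ∧ (rest = [] ∨ splits b rest) := by
  induction x with
  | nil => exact absurd rfl hx
  | cons a t ih =>
    rw [atoms_cons]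
    split_ifs with h
    · exact ⟨[a], t, rfl, rfl, by simp, Or.inr (splits_single.2 h)⟩
    · cases t with
      | nil => exact ⟨[a], [], rfl, rfl, by simp, Or.inl rfl⟩
      | cons c t =>
        obtain ⟨b, rest, h1, h2, h3, h4⟩ := ih (by simp)
        refine ⟨a :: b, rest, by rw [h1]; rfl, by rw [h2]; rfl, by simp, h4.imp id ?_⟩
        intro h5
        exact splits_append (u₁ := [a]) h5

/-! ### Decay into elements -/

theorem atoms_induction {P : List ℕ → Prop} (h0 : P [])
    (h1 : ∀ u v, splits u v → P u → P v → P (u ++ v)) (x : List ℕ) (hx : ∀ b ∈ atoms x, P b) :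
    P x := by
  induction hn : x.length using Nat.strong_induction_on generalizing x with
  | _ n ih =>
    by_cases hx0 : x = []
    · rw [hx0]; exact h0
    · obtain ⟨b, rest, h2, h3, h4, h5⟩ := atoms_struct x hx0
      rw [h3] at hx
      have hb : P b := hx b (by simp)
      rcases h5 with rfl | h5
      · rw [h2, List.append_nil]; exact hb
      · rw [h2]
        refine h1 _ _ h5 hb (ih rest.length ?_ rest (fun c hc => hx c (by simp [hc])) rfl)
        rw [← hn, h2, List.length_append]
        have := List.length_pos_iff.2 h4
        omega

/-- All atoms of the word are elements. -/
def AllE (y : List ℕ) : Prop := ∀ b ∈ atoms y, isE b = true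

theorem AllE_append {u v : List ℕ} (h : splits u v) : AllE (u ++ v) ↔ AllE u ∧ AllE v := by
  simp only [AllE, atoms_append h, List.mem_append]
  constructor
  · intro h; exact ⟨fun b hb => h b (Or.inl hb), fun b hb => h b (Or.inr hb)⟩
  · rintro ⟨h1, h2⟩ b (hb | hb)
    · exact h1 b hb
    · exact h2 b hb

theorem leq_eq {x y : List ℕ} (h : leq x y = true) : x = y := by
  induction x generalizing y with
  | nil =>
    cases y with
    | nil => rfl
    | cons b u => exact absurd h Bool.false_ne_true
  | cons a x ih =>
    cases y with
    | nil => exact absurd h Bool.false_ne_true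
    | cons b u =>
      change Bool.rec false (leq x u) (Nat.beq a b) = true at h
      rw [rec_false_iff, Nat.beq_eq] at h
      rw [h.1, ih h.2]

theorem memc_sound {b : List ℕ} {c : ℕ} {t : BT} (h : t.memc b c = true) :
    ∃ n ∈ t.toL, b = dec n := by
  induction t with
  | lf => exact absurd h Bool.false_ne_true
  | bn l n r ihl ihr =>
    change Bool.rec (Bool.rec (r.memc b c) (l.memc b c) (Nat.ble c n)) (leq b (dec n))
      (Nat.beq c n) = true at h
    change ∃ m ∈ l.toL ++ n :: r.toL, b = dec m
    cases h1 : Nat.beq c n with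
    | true =>
      rw [h1] at h
      exact ⟨n, by simp, leq_eq h⟩
    | false =>
      rw [h1] at h
      cases h2 : Nat.ble c n with
      | true =>
        rw [h2] at h
        obtain ⟨m, h3, h4⟩ := ihl h
        exact ⟨m, by simp [h3], h4⟩
      | false =>
        rw [h2] at h
        obtain ⟨m, h3, h4⟩ := ihr h
        exact ⟨m, by simp [h3], h4⟩

theorem isE_mem {b : List ℕ} (h : isE b = true) : ∃ n ∈ ebt.toL, b = dec n := memc_sound h

theorem isE_AllE_C {b : List ℕ} (h : isE b = true) : AllE (C b) := by
  obtain ⟨n, h1, rfl⟩ := isE_mem h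
  have := ebt_closed
  rw [List.all_eq_true] at this
  have h2 := this n h1
  rw [List.all_eq_true] at h2
  exact h2

theorem AllE_C {x : List ℕ} (h : AllE x) : AllE (C x) := by
  refine atoms_induction (P := fun x => AllE (C x)) ?_ ?_ x (fun b hb => isE_AllE_C (h b hb))
  · intro b hb; simp [C_nil, atoms_nil] at hb
  · intro u v huv hu hv
    rw [(splits_C huv).1, AllE_append (splits_C huv).2]
    exact ⟨hu, hv⟩

theorem AllE_iter {x : List ℕ} (h : AllE x) (n : ℕ) : AllE (C^[n] x) := by
  induction n with
  | zero => exact h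
  | succ n ih => rw [Function.iterate_succ_apply']; exact AllE_C ih

/-- The word eventually decays into elements. -/
def Pat (x : List ℕ) : Prop := ∃ N, AllE (C^[N] x)

theorem Pat_C {x : List ℕ} : Pat (C x) ↔ Pat x := by
  constructor
  · rintro ⟨N, h⟩; exact ⟨N + 1, h⟩
  · rintro ⟨N, h⟩
    refine ⟨N, ?_⟩
    rw [← Function.iterate_succ_apply, Function.iterate_succ_apply']
    exact AllE_C h

theorem Pat_iter {x : List ℕ} (n : ℕ) : Pat (C^[n] x) ↔ Pat x := by
  induction n with
  | zero => rfl
  | succ n ih => rw [Function.iterate_succ_apply', Pat_C, ih]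

theorem Pat_append {u v : List ℕ} (h : splits u v) : Pat (u ++ v) ↔ Pat u ∧ Pat v := by
  constructor
  · rintro ⟨N, hN⟩
    rw [(splits_iter h N).1, AllE_append (splits_iter h N).2] at hN
    exact ⟨⟨N, hN.1⟩, ⟨N, hN.2⟩⟩
  · rintro ⟨⟨N, hN⟩, ⟨M, hM⟩⟩
    refine ⟨N + M, ?_⟩
    rw [(splits_iter h _).1, AllE_append (splits_iter h _).2]
    constructor
    · rw [add_comm, Function.iterate_add_apply]; exact AllE_iter hN M
    · rw [Function.iterate_add_apply]; exact AllE_iter hM N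

theorem isE_Pat {b : List ℕ} (h : isE b = true) : Pat b := ⟨1, isE_AllE_C h⟩

theorem Pat_nil : Pat [] := ⟨0, fun b hb => by simp [atoms_nil] at hb⟩

theorem good_sound {n : ℕ} {x : List ℕ} (h : good n x = true) : Pat x := by
  induction n generalizing x with
  | zero => exact absurd h Bool.false_ne_true
  | succ n ih =>
    change List.rec true (fun b _ r =>
      Bool.rec (Bool.rec false r (good n b)) r (isE b)) (atoms (C x)) = true at h
    rw [← Pat_C]
    refine atoms_induction Pat_nil (fun u v huv hu hv => (Pat_append huv).2 ⟨hu, hv⟩) _ ?_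
    generalize atoms (C x) = l at h
    induction l with
    | nil => simp
    | cons b l ihl =>
      have key : (isE b = true ∨ good n b = true) ∧ ∀ c ∈ l, Pat c := by
        cases h1 : isE b with
        | true =>
          simp only [h1] at h
          exact ⟨Or.inl rfl, ihl h⟩
        | false =>
          simp only [h1] at h
          rw [rec_false_iff] at h
          exact ⟨Or.inr h.1, ihl h.2⟩
      intro c hc
      rcases List.mem_cons.1 hc with rfl | hc
      · exact key.1.elim isE_Pat ih
      · exact key.2 c hc

theorem cutHere_sound {c : ℕ} {A B : List ℕ} (h : cutHere c A B = true) (S : List ℕ)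
    (hB : Pat (S ++ c :: B)) : Pat (S ++ c :: A) := by
  unfold cutHere at h
  rw [rec_false_iff] at h
  obtain ⟨h1, h2⟩ := h
  have h3 : Pat (S ++ [c]) := by
    cases B with
    | nil => exact hB
    | cons b B =>
      have : splits (S ++ [c]) (b :: B) := splits_append (splits_single.2 h1)
      rw [List.append_cons, Pat_append this] at hB
      exact hB.1
  cases A with
  | nil => exact h3
  | cons a A =>
    change Bool.rec false (good 24 (a :: A)) (sp c (a :: A)) = true at h2
    rw [rec_false_iff] at h2
    have : splits (S ++ [c]) (a :: A) := splits_append (splits_single.2 h2.1)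
    rw [List.append_cons, Pat_append this]
    exact ⟨h3, good_sound h2.2⟩

theorem cut_sound {A : List ℕ} {c : ℕ} {B : List ℕ} (h : cut A c B = true) (S : List ℕ)
    (hB : Pat (S ++ c :: B)) : Pat (S ++ c :: A) := by
  induction A generalizing c B S with
  | nil =>
    have h' : cutHere c [] B = true := h
    exact cutHere_sound h' S hB
  | cons a A ih =>
    change Bool.rec (List.rec false (fun b B' _ => Bool.rec false (cut A a B') (Nat.beq a b)) B) true
      (cutHere c (a :: A) B) = true at h
    cases h1 : cutHere c (a :: A) B with
    | true => exact cutHere_sound h1 S hB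
    | false =>
      simp only [h1] at h
      cases B with
      | nil => exact absurd h Bool.false_ne_true
      | cons b B =>
        change Bool.rec false (cut A a B) (Nat.beq a b) = true at h
        rw [rec_false_iff, Nat.beq_eq] at h
        obtain ⟨rfl, h⟩ := h
        rw [List.append_cons] at hB ⊢
        exact ih h _ hB

theorem C_run_append (S : List ℕ) (a : ℕ) : ∀ k : ℕ, ∃ S', ∀ A, lead a A = k →
    C (S ++ a :: A) = S' ++ a :: C (drp a A) := by
  intro k
  have h : (C (S ++ List.replicate (k + 1) a)).getLast? = some a := by
    rw [C_last]; simp [List.replicate_succ']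
  refine ⟨(C (S ++ List.replicate (k + 1) a)).dropLast, ?_⟩
  rintro A rfl
  have h2 : S ++ a :: A = (S ++ List.replicate (lead a A + 1) a) ++ drp a A := by
    conv_lhs => rw [lead_drp a A]
    rw [List.replicate_succ]; simp
  rw [h2, C_append]
  · conv_lhs => rw [← List.dropLast_append_getLast? a h]
    simp
  · intro a' ha'
    have : a = a' := by simpa [List.replicate_succ'] using ha'
    subst this
    exact drp_head a A

theorem pchk_sound {t : ℕ} {A B : List ℕ} (h : pchk t A B = true) (S : List ℕ)
    (hB : Pat (S ++ B)) : Pat (S ++ A) := by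
  induction t generalizing A B S with
  | zero =>
    cases A with
    | nil => exact absurd h Bool.false_ne_true
    | cons a A =>
      cases B with
      | nil => exact absurd h Bool.false_ne_true
      | cons b B =>
        change Bool.rec false (cut A a B) (Nat.beq a b) = true at h
        rw [rec_false_iff, Nat.beq_eq] at h
        obtain ⟨rfl, h⟩ := h
        exact cut_sound h S hB
  | succ t ih =>
    cases A with
    | nil => exact absurd h Bool.false_ne_true
    | cons a A =>
      cases B with
      | nil => exact absurd h Bool.false_ne_true
      | cons b B =>
        change Bool.rec false (Bool.rec false (pchk t (a :: C (drp a A)) (a :: C (drp a B)))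
          (Nat.beq (lead a A) (lead a B))) (Nat.beq a b) = true at h
        rw [rec_false_iff, rec_false_iff, Nat.beq_eq, Nat.beq_eq] at h
        obtain ⟨rfl, h1, h2⟩ := h
        obtain ⟨S', hS⟩ := C_run_append S a (lead a A)
        rw [← Pat_C, hS B h1.symm] at hB
        rw [← Pat_C, hS A rfl]
        exact ih h2 S' hB

theorem child_nd {a : ℕ} {t : Tr} (h : isNd (child a t) = true) :
    isNd t = true ∧ (a = 1 ∨ a = 2 ∨ a = 3) := by
  cases t with
  | no => exact absurd h Bool.false_ne_true
  | rd s t => exact absurd h Bool.false_ne_true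
  | nd x y z =>
    refine ⟨rfl, ?_⟩
    by_contra h1
    change isNd (Bool.rec (Bool.rec (Bool.rec Tr.no z (Nat.beq a 3)) y (Nat.beq a 2)) x
      (Nat.beq a 1)) = true at h
    simp only [not_or] at h1
    simp only [beq_eq, h1, decide_false] at h
    exact absurd h Bool.false_ne_true

theorem chk_nd {x y z : Tr} {w : List ℕ} (h : chk (Tr.nd x y z) w = true) :
    good 24 w = true ∧ chk x (1 :: w) = true ∧ chk y (2 :: w) = true ∧ chk z (3 :: w) = true := by
  change Bool.rec false (Bool.rec false (Bool.rec false (chk z (3 :: w)) (chk y (2 :: w)))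
    (chk x (1 :: w))) (good 24 w) = true at h
  rw [rec_false_iff, rec_false_iff, rec_false_iff] at h
  exact h

theorem chk_child {t : Tr} {w : List ℕ} (h : chk t w = true) (ht : isNd t = true) {a : ℕ}
    (ha : a = 1 ∨ a = 2 ∨ a = 3) : chk (child a t) (a :: w) = true := by
  cases t with
  | no => exact absurd ht Bool.false_ne_true
  | rd s t => exact absurd ht Bool.false_ne_true
  | nd x y z =>
    have := chk_nd h
    rcases ha with rfl | rfl | rfl
    · exact this.2.1
    · exact this.2.2.1
    · exact this.2.2.2

theorem stt_cons {a : ℕ} {w : List ℕ} (ha : a = 1 ∨ a = 2 ∨ a = 3) :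
    stt (a :: w) = child a (stt w) := by
  cases w with
  | nil => rcases ha with rfl | rfl | rfl <;> rfl
  | cons b w => rfl

theorem chk_stt {w : List ℕ} (h : isNd (stt w) = true) : chk (stt w) w = true := by
  induction w with
  | nil => exact chk_t0
  | cons a w ih =>
    by_cases hw : w = [] ∧ a = 4
    · obtain ⟨rfl, rfl⟩ := hw
      exact chk_t4
    · have h1 : stt (a :: w) = child a (stt w) := by
        cases w with
        | nil =>
          have h4 : a ≠ 4 := by simpa using hw
          change @Bool.rec (fun _ => Tr) (child a t0) t4 (Nat.beq a 4) = _
          rw [beq_eq, decide_eq_false h4]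
          rfl
        | cons b w => rfl
      rw [h1] at h ⊢
      obtain ⟨h2, h3⟩ := child_nd h
      exact chk_child (ih h2) h2 h3

theorem sameLead_sound {A B : List ℕ} (h : sameLead A B = true) (z : ℕ) : lead z A = lead z B := by
  cases A with
  | nil => exact absurd h Bool.false_ne_true
  | cons a A =>
    cases B with
    | nil => exact absurd h Bool.false_ne_true
    | cons b B =>
      change Bool.rec false (Nat.beq (lead a A) (lead a B)) (Nat.beq a b) = true at h
      rw [rec_false_iff, Nat.beq_eq, Nat.beq_eq] at h
      obtain ⟨rfl, h⟩ := h
      rw [lead_cons, lead_cons]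
      split_ifs with h1
      · rw [h1, h]
      · rfl

theorem Pat_main (l : List ℕ) (hl : ∀ c ∈ l, c = 1 ∨ c = 2 ∨ c = 3) (w : List ℕ)
    (hw : isNd (stt w) = true) (h3 : r3 (l ++ w) = true) : Pat (l ++ w) := by
  induction l using List.reverseRecOn generalizing w with
  | nil =>
    have h := chk_stt hw
    cases hs : stt w with
    | no => rw [hs] at hw; exact absurd hw Bool.false_ne_true
    | rd s t => rw [hs] at hw; exact absurd hw Bool.false_ne_true
    | nd x y z =>
      rw [hs] at h
      exact good_sound (chk_nd h).1
  | append_singleton l a ih =>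
    rw [← List.append_cons] at h3 ⊢
    have ha := hl a (by simp)
    have hl' : ∀ c ∈ l, c = 1 ∨ c = 2 ∨ c = 3 := fun c hc => hl c (by simp [hc])
    have h := chk_child (chk_stt hw) hw ha
    cases hs : child a (stt w) with
    | no =>
      rw [hs] at h
      change Nat.ble 3 (lead a w) = true at h
      rw [Nat.ble_eq] at h
      have := ((r3_cons a w).1 (r3_suffix _ _ h3)).1
      omega
    | rd t s =>
      rw [hs] at h
      change Bool.rec false (Bool.rec false (Bool.rec false (pchk t (a :: w) (dec s))
        (isNd (stt (dec s)))) (sameLead (a :: w) (dec s))) (r3 (dec s)) = true at h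
      rw [rec_false_iff, rec_false_iff, rec_false_iff] at h
      obtain ⟨h4, h5, h6, h7⟩ := h
      exact pchk_sound h7 l
        (ih hl' _ h6 (r3_append_congr (sameLead_sound h5) h4 l h3))
    | nd x y z =>
      refine ih hl' _ ?_ h3
      rw [stt_cons ha, hs]; rfl

theorem Pat_123 (l : List ℕ) (hl : ∀ c ∈ l, c = 1 ∨ c = 2 ∨ c = 3) (h : r3 l = true) : Pat l := by
  simpa using Pat_main l hl [] rfl (by simpa using h)

theorem Pat_1234 (l : List ℕ) (hl : ∀ c ∈ l, c = 1 ∨ c = 2 ∨ c = 3) (h : r3 (l ++ [4]) = true) :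
    Pat (l ++ [4]) := Pat_main l hl [4] rfl h

/-! ### Reduction of general words -/

theorem lead_replicate (a k : ℕ) : lead a (List.replicate k a) = k := by
  induction k with
  | zero => rfl
  | succ k ih => rw [List.replicate_succ, lead_cons, if_pos rfl, ih]

theorem drp_replicate (a k : ℕ) : drp a (List.replicate k a) = [] := by
  induction k with
  | zero => rfl
  | succ k ih => rw [List.replicate_succ, drp_cons, if_pos rfl, ih]

theorem C_replicate (a k : ℕ) : C (List.replicate (k + 1) a) = [k + 1, a] := by
  rw [List.replicate_succ, C_run, lead_replicate, drp_replicate, C_nil]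

theorem exists_run {α : Type*} [DecidableEq α] (x : List α) (hx : x ≠ []) :
    ∃ k a t, x = List.replicate (k + 1) a ++ t ∧ ∀ b ∈ t.head?, a ≠ b := by
  induction x with
  | nil => exact absurd rfl hx
  | cons a x ih =>
    cases x with
    | nil => exact ⟨0, a, [], rfl, by simp⟩
    | cons b x =>
      obtain ⟨k, c, t, h1, h2⟩ := ih (by simp)
      by_cases hab : a = c
      · exact ⟨k + 1, c, t, by rw [h1, hab]; rfl, h2⟩
      · refine ⟨0, a, b :: x, rfl, ?_⟩
        have : b = c := by
          rw [List.replicate_succ, List.cons_append] at h1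
          exact (List.cons_eq_cons.1 h1).1
        simpa [this] using hab

theorem map_lookAndSay (x : List ℕ+) :
    (lookAndSay x).map PNat.val = C (x.map PNat.val) := by
  induction hn : x.length using Nat.strong_induction_on generalizing x with
  | _ n ih =>
    by_cases hx : x = []
    · subst hx; rfl
    · obtain ⟨k, a, t, rfl, h⟩ := exists_run x hx
      have ht := ih t.length (by rw [← hn]; simp) t rfl
      rw [List.map_append, C_append, ← ht, List.map_replicate, C_replicate]
      · unfold lookAndSay
        rw [List.splitBy_append, List.splitBy_of_isChain]
        · simp only [List.flatMap_append, List.map_append]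
          congr 1
          simp [List.replicate_succ]
        · simp
        · rw [List.isChain_iff_getElem]
          simp
        · intro b hb c hc
          have : a = b := by simpa [List.replicate_succ'] using hb
          subst this
          simpa using h c hc
      · intro b hb c hc
        rw [List.map_replicate, List.replicate_succ', List.getLast?_concat] at hb
        obtain rfl : PNat.val a = b := by simpa using hb
        rw [List.head?_map] at hc
        obtain ⟨d, hd, rfl⟩ := Option.mem_map.1 hc
        intro h1
        exact h d hd (PNat.eq h1)

theorem map_lookAndSay_iter (n : ℕ) (x : List ℕ+) :
    (lookAndSay^[n] x).map PNat.val = C^[n] (x.map PNat.val) := by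
  induction n with
  | zero => rfl
  | succ n ih => rw [Function.iterate_succ_apply', map_lookAndSay, ih, Function.iterate_succ_apply']

/-- Words consisting of pairs of a multiplicity at most three and a letter. -/
inductive PW : List ℕ → Prop
  | nil : PW []
  | cons (k a : ℕ) (r : List ℕ) (h1 : 1 ≤ k) (h3 : k ≤ 3) (ha : 1 ≤ a) (hr : PW r) :
      PW (k :: a :: r)

theorem mem_drp {a c : ℕ} {x : List ℕ} (h : c ∈ drp a x) : c ∈ x := by
  rw [lead_drp a x]; simp [h]

theorem PW_C (x : List ℕ) (h : r3 x = true) (hx : ∀ c ∈ x, 1 ≤ c) : PW (C x) := by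
  induction hn : x.length using Nat.strong_induction_on generalizing x with
  | _ n ih =>
    cases x with
    | nil => exact PW.nil
    | cons a t =>
      rw [C_run]
      have h1 := (r3_cons a t).1 h
      have h2 : r3 (drp a t) = true := by
        have h3 := h1.2
        rw [lead_drp a t] at h3
        exact r3_suffix _ _ h3
      refine PW.cons _ _ _ (by omega) (by omega) (hx a (by simp)) (ih _ ?_ _ h2 ?_ rfl)
      · rw [← hn]
        have := drp_length a t
        simp only [List.length_cons]; omega
      · intro c hc
        exact hx c (by simp [mem_drp hc])

theorem C_pos (x : List ℕ) (hx : ∀ c ∈ x, 1 ≤ c) : ∀ c ∈ C x, 1 ≤ c := by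
  induction x with
  | nil => simp [C_nil]
  | cons a x ih =>
    have ih := ih (fun c hc => hx c (by simp [hc]))
    have ha := hx a (by simp)
    rw [C_cons]
    cases x with
    | nil => simpa [C_nil, push_nil] using ha
    | cons b x =>
      rw [C_run] at ih ⊢
      rw [push_cons]
      simp only [List.mem_cons, forall_eq_or_imp] at ih
      split_ifs <;> simp only [List.mem_cons, forall_eq_or_imp]
      · exact ⟨by omega, ih.2⟩
      · exact ⟨le_rfl, ha, ih⟩

theorem head_C_le {v : List ℕ} (h : r3 v = true) : ∀ b ∈ (C v).head?, b ≤ 3 := by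
  cases v with
  | nil => simp [C_nil]
  | cons a t =>
    rw [C_run]
    have := ((r3_cons a t).1 h).1
    simp; omega

theorem persist {u v : List ℕ} {a : ℕ} (ha : 4 ≤ a) (hu : u.getLast? = some a)
    (hv : r3 v = true) (hh : ∀ b ∈ v.head?, b ≤ 3) (n : ℕ) :
    C^[n] (u ++ v) = C^[n] u ++ C^[n] v := by
  induction n generalizing u v with
  | zero => rfl
  | succ n ih =>
    simp only [Function.iterate_succ_apply]
    rw [C_append, ih (by rw [C_last, hu]) (r3_C v) (head_C_le hv)]
    intro a' ha' b hb
    obtain rfl : a = a' := by rw [hu] at ha'; simpa using ha'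
    have := hh b hb
    omega

theorem lead_map {f : ℕ → ℕ} (hf : Function.Injective f) (a : ℕ) (x : List ℕ) :
    lead (f a) (x.map f) = lead a x := by
  induction x with
  | nil => rfl
  | cons b x ih => simp only [List.map_cons, lead_cons, hf.eq_iff, ih]

theorem drp_map {f : ℕ → ℕ} (hf : Function.Injective f) (a : ℕ) (x : List ℕ) :
    drp (f a) (x.map f) = (drp a x).map f := by
  induction x with
  | nil => rfl
  | cons b x ih =>
    simp only [List.map_cons, drp_cons, hf.eq_iff, ih]
    split_ifs <;> simp

theorem C_map {f : ℕ → ℕ} (hf : Function.Injective f) (h3 : ∀ k ≤ 3, f k = k) (x : List ℕ)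
    (h : r3 x = true) : C (x.map f) = (C x).map f := by
  induction hn : x.length using Nat.strong_induction_on generalizing x with
  | _ n ih =>
    cases x with
    | nil => rfl
    | cons a t =>
      have h1 := (r3_cons a t).1 h
      have h2 : r3 (drp a t) = true := by
        have h3 := h1.2
        rw [lead_drp a t] at h3
        exact r3_suffix _ _ h3
      rw [List.map_cons, C_run, C_run, lead_map hf, drp_map hf, List.map_cons, List.map_cons,
        h3 (lead a t + 1) (by omega), ih _ ?_ _ h2 rfl]
      rw [← hn]
      have := drp_length a t
      simp only [List.length_cons]; omega

theorem C_map_iter {f : ℕ → ℕ} (hf : Function.Injective f) (h3 : ∀ k ≤ 3, f k = k) (x : List ℕ)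
    (h : r3 x = true) (n : ℕ) : C^[n] (x.map f) = (C^[n] x).map f := by
  induction n generalizing x with
  | zero => rfl
  | succ n ih =>
    simp only [Function.iterate_succ_apply]
    rw [C_map hf h3 x h, ih _ (r3_C x)]

theorem r3_map {f : ℕ → ℕ} (hf : Function.Injective f) (x : List ℕ) (h : r3 x = true) :
    r3 (x.map f) = true := by
  induction x with
  | nil => rfl
  | cons a x ih =>
    rw [r3_cons] at h
    rw [List.map_cons, r3_cons, lead_map hf]
    exact ⟨h.1, ih h.2⟩

theorem reduction_aux {Q : List ℕ → Prop} (hPat : ∀ x, Pat x → Q x)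
    (happ : ∀ u v, (∀ n, C^[n] (u ++ v) = C^[n] u ++ C^[n] v) → Q u → Q v → Q (u ++ v))
    (hswap : ∀ (f : ℕ → ℕ) x, Function.Injective f → (∀ k ≤ 3, f k = k) →
      (∀ n, C^[n] (x.map f) = (C^[n] x).map f) → Q (x.map f) → Q x)
    {y : List ℕ} (hy : PW y) (p : List ℕ) (hp : ∀ c ∈ p, c = 1 ∨ c = 2 ∨ c = 3)
    (h3 : r3 (p ++ y) = true) : Q (p ++ y) := by
  induction hy generalizing p with
  | nil =>
    rw [List.append_nil] at h3 ⊢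
    exact hPat _ (Pat_123 p hp h3)
  | cons k a r h1 hk ha hr ih =>
    have e : p ++ k :: a :: r = (p ++ [k, a]) ++ r := by simp
    rw [e] at h3 ⊢
    by_cases h4 : a ≤ 3
    · refine ih _ ?_ h3
      intro c hc
      rcases List.mem_append.1 hc with hc | hc
      · exact hp c hc
      · simp only [List.mem_cons, List.not_mem_nil, or_false] at hc
        omega
    · have hr3 := r3_suffix _ _ h3
      have hu3 := r3_prefix _ _ h3
      refine happ _ _ ?_ ?_ ?_
      · refine persist (a := a) (by omega) (by simp) hr3 ?_
        cases hr with
        | nil => simp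
        | cons k' a' r' _ hk' => simpa using hk'
      · have hf : Function.Injective (Equiv.swap 4 a) := (Equiv.swap 4 a).injective
        have hf3 : ∀ k ≤ 3, Equiv.swap 4 a k = k := fun k hk =>
          Equiv.swap_apply_of_ne_of_ne (by omega) (by omega)
        refine hswap (Equiv.swap 4 a) _ hf hf3 (fun n => C_map_iter hf hf3 _ hu3 n) (hPat _ ?_)
        have e2 : (p ++ [k, a]).map (Equiv.swap 4 a) = (p ++ [k]) ++ [4] := by
          have : p.map (Equiv.swap 4 a) = p := by
            conv_rhs => rw [← List.map_id p]
            refine List.map_congr_left ?_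
            intro c hc
            rw [hf3 c (by have := hp c hc; omega)]; rfl
          simp [this, hf3 k hk]
        have h5 := r3_map hf _ hu3
        rw [e2] at h5 ⊢
        refine Pat_1234 _ ?_ h5
        intro c hc
        rcases List.mem_append.1 hc with hc | hc
        · exact hp c hc
        · simp only [List.mem_cons, List.not_mem_nil, or_false] at hc
          omega
      · exact ih [] (by simp) hr3

theorem reduction {Q : List ℕ → Prop} (hPat : ∀ x, Pat x → Q x) (hC : ∀ x, Q (C x) → Q x)
    (happ : ∀ u v, (∀ n, C^[n] (u ++ v) = C^[n] u ++ C^[n] v) → Q u → Q v → Q (u ++ v))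
    (hswap : ∀ (f : ℕ → ℕ) x, Function.Injective f → (∀ k ≤ 3, f k = k) →
      (∀ n, C^[n] (x.map f) = (C^[n] x).map f) → Q (x.map f) → Q x)
    (x : List ℕ) (hx : ∀ c ∈ x, 1 ≤ c) : Q x :=
  hC _ (hC _ (reduction_aux hPat happ hswap (PW_C _ (r3_C x) (C_pos x hx)) [] (by simp)
    (r3_C _)))

/-! ### Growth rates -/

open Filter in
/-- The eventually positive sequence `d` grows with rate `lam`. -/
def Good (lam : ℝ) (d : ℕ → ℝ) : Prop :=
  (∀ᶠ n in atTop, 0 < d n) ∧ ∀ ε > 0, ∀ᶠ n in atTop, |d (n + 1) - lam * d n| ≤ ε * d n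

theorem Good.add {lam : ℝ} {d e : ℕ → ℝ} (hd : Good lam d) (he : Good lam e) :
    Good lam (fun n => d n + e n) := by
  refine ⟨?_, fun ε hε => ?_⟩
  · filter_upwards [hd.1, he.1] with n h1 h2
    exact add_pos h1 h2
  · filter_upwards [hd.2 ε hε, he.2 ε hε] with n h1 h2
    have : d (n + 1) + e (n + 1) - lam * (d n + e n)
        = (d (n + 1) - lam * d n) + (e (n + 1) - lam * e n) := by ring
    rw [this]
    calc _ ≤ |d (n + 1) - lam * d n| + |e (n + 1) - lam * e n| := abs_add_le _ _
      _ ≤ ε * d n + ε * e n := add_le_add h1 h2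
      _ = _ := by ring

open Filter in
theorem Good.congr {lam : ℝ} {d e : ℕ → ℝ} (hd : Good lam d) (N : ℕ) (h : ∀ n ≥ N, e n = d n) :
    Good lam e := by
  refine ⟨?_, fun ε hε => ?_⟩
  · filter_upwards [hd.1, eventually_ge_atTop N] with n h1 h2
    rwa [h n h2]
  · filter_upwards [hd.2 ε hε, eventually_ge_atTop N] with n h1 h2
    rwa [h n h2, h (n + 1) (by omega)]

open Filter in
theorem ev_shift (k : ℕ) (P : ℕ → Prop) :
    (∀ᶠ n in atTop, P (n + k)) ↔ ∀ᶠ n in atTop, P n := by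
  conv_rhs => rw [← map_add_atTop_eq_nat k, eventually_map]

open Filter in
theorem good_shift {lam : ℝ} {d : ℕ → ℝ} (k : ℕ) :
    Good lam (fun n => d (n + k)) ↔ Good lam d := by
  unfold Good
  rw [← ev_shift k (fun n => 0 < d n)]
  refine and_congr Iff.rfl (forall_congr' fun ε => forall_congr' fun _ => ?_)
  rw [← ev_shift k (fun n => |d (n + 1) - lam * d n| ≤ ε * d n)]
  simp only [add_right_comm]

theorem bdd_of_lag {s N : ℕ} (hs : 1 ≤ s) {f : ℕ → ℝ} (h : ∀ n ≥ N, f (n + s) ≤ f n) :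
    ∃ K, ∀ n ≥ N, f n ≤ K := by
  refine ⟨∑ i ∈ Finset.range s, |f (N + i)|, ?_⟩
  intro n hn
  induction n using Nat.strong_induction_on with
  | _ n ih =>
    by_cases h1 : n < N + s
    · have h2 : n - N ∈ Finset.range s := by simp; omega
      have h3 := Finset.single_le_sum (f := fun i => |f (N + i)|) (fun i _ => abs_nonneg _) h2
      have h4 : N + (n - N) = n := by omega
      simp only [h4] at h3
      exact (le_abs_self _).trans h3
    · have h2 := h (n - s) (by omega)
      rw [Nat.sub_add_cancel (by omega)] at h2
      exact h2.trans (ih (n - s) (by omega) (by omega))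

open Filter in
theorem good_lag {lam : ℝ} (hlam : 1 < lam) {s : ℕ} (hs : 1 ≤ s) {p g : ℕ → ℝ}
    (hg : Good lam g) (h : ∀ n, p (n + s) = p n + g n) : Good lam p := by
  have hpt : Tendsto p atTop atTop := by
    have h1 := hg.2 (lam - 1) (by linarith)
    obtain ⟨N, hN⟩ := eventually_atTop.1 (hg.1.and h1)
    have hmono : ∀ n ≥ N, g N ≤ g n := by
      intro n hn
      induction n, hn using Nat.le_induction with
      | base => exact le_rfl
      | succ n hn ih =>
        obtain ⟨h2, h3⟩ := hN n hn
        have h4 := (abs_le.1 h3).1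
        nlinarith
    have hc := (hN N le_rfl).1
    have hs0 : (0 : ℝ) < s := by exact_mod_cast hs
    obtain ⟨K, hK⟩ := bdd_of_lag (N := N) hs (f := fun n => g N / s * n - p n) (by
      intro n hn
      have h2 := hmono n hn
      have h3 : g N / s * s = g N := div_mul_cancel₀ _ hs0.ne'
      simp only [h, Nat.cast_add, mul_add, h3]
      linarith)
    have ht : Tendsto (fun n : ℕ => g N / s * (n : ℝ) + (-K)) atTop atTop :=
      tendsto_atTop_add_const_right _ _
        (Tendsto.const_mul_atTop (div_pos hc hs0) tendsto_natCast_atTop_atTop)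
    refine tendsto_atTop_mono' _ ?_ ht
    filter_upwards [eventually_ge_atTop N] with n hn
    have := hK n hn
    linarith
  refine ⟨hpt.eventually_gt_atTop 0, fun ε hε => ?_⟩
  obtain ⟨N, hN⟩ := eventually_atTop.1 (hg.2 (ε / 2) (by linarith))
  obtain ⟨K, hK⟩ := bdd_of_lag (N := N) hs
    (f := fun n => |p (n + 1) - lam * p n| - ε / 2 * p n) (by
      intro n hn
      have h2 := hN n hn
      have h3 : p (n + s + 1) = p (n + 1) + g (n + 1) := by rw [← h]; congr 1; omega
      have h4 : p (n + s + 1) - lam * p (n + s)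
        = (p (n + 1) - lam * p n) + (g (n + 1) - lam * g n) := by rw [h3, h]; ring
      have h5 := abs_add_le (p (n + 1) - lam * p n) (g (n + 1) - lam * g n)
      simp only [h4]
      rw [h n]
      linarith)
  filter_upwards [eventually_ge_atTop N, hpt.eventually_ge_atTop (K / (ε / 2))] with n hn h2
  have h3 := hK n hn
  rw [div_le_iff₀ (by linarith)] at h2
  linarith

open Filter in
theorem good_ratio {lam : ℝ} {p : ℕ → ℝ} (hp : Good lam p) :
    Tendsto (fun n => p (n + 1) / p n) atTop (nhds lam) := by
  rw [Metric.tendsto_atTop]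
  intro ε hε
  obtain ⟨N, hN⟩ := eventually_atTop.1 (hp.1.and (hp.2 (ε / 2) (by linarith)))
  refine ⟨N, fun n hn => ?_⟩
  obtain ⟨h1, h2⟩ := hN n hn
  rw [Real.dist_eq]
  have h3 : p (n + 1) / p n - lam = (p (n + 1) - lam * p n) / p n := by
    field_simp
  rw [h3, abs_div, abs_of_pos h1, div_lt_iff₀ h1]
  nlinarith

/-- Comparison of a subinvariant and a superinvariant positive vector. -/
theorem cw {ι : Type*} [Fintype ι] [Nonempty ι] (op : (ι → ℝ) →ₗ[ℝ] (ι → ℝ))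
    (hop : ∀ f, 0 ≤ f → 0 ≤ op f) (x y : ι → ℝ) (hx : ∀ i, 0 < x i) (hy : ∀ i, 0 < y i) (a b : ℝ)
    (hb0 : 0 < b) (ha : a • x ≤ op x) (hb : op y ≤ b • y) : a ≤ b := by
  by_contra! hab
  have i0 : ι := Classical.arbitrary ι
  have mono : ∀ f g : ι → ℝ, f ≤ g → op f ≤ op g := by
    intro f g hfg
    have := hop (g - f) (sub_nonneg.2 hfg)
    rw [map_sub] at this
    exact sub_nonneg.1 this
  obtain ⟨K, hK0, hK⟩ : ∃ K : ℝ, 0 < K ∧ x ≤ K • y := by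
    have h0 : ∀ i, 0 < x i / y i := fun i => div_pos (hx i) (hy i)
    refine ⟨∑ i, x i / y i, Finset.sum_pos (fun i _ => h0 i) ⟨i0, Finset.mem_univ _⟩, ?_⟩
    intro i
    have h1 := Finset.single_le_sum (f := fun i => x i / y i) (fun i _ => (h0 i).le)
      (Finset.mem_univ i)
    simp only [Pi.smul_apply, smul_eq_mul]
    rw [← div_le_iff₀ (hy i)]
    exact h1
  have hk : ∀ k : ℕ, a ^ k • x ≤ (K * b ^ k) • y := by
    have h1 : ∀ k : ℕ, a ^ k • x ≤ (op ^ k) x := by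
      intro k
      induction k with
      | zero => simp
      | succ k ih =>
        have h2 := mono _ _ ih
        rw [map_smul] at h2
        calc a ^ (k + 1) • x = a ^ k • (a • x) := by rw [smul_smul, pow_succ]
          _ ≤ a ^ k • op x := by
            refine smul_le_smul_of_nonneg_left ha (pow_nonneg (by linarith) k)
          _ ≤ (op ^ (k + 1)) x := by rw [pow_succ']; exact h2
    have h2 : ∀ k : ℕ, (op ^ k) x ≤ (K * b ^ k) • y := by
      intro k
      induction k with
      | zero => simpa using hK
      | succ k ih =>
        have h3 := mono _ _ ih
        rw [map_smul] at h3
        calc (op ^ (k + 1)) x = op ((op ^ k) x) := by rw [pow_succ']; rfl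
          _ ≤ (K * b ^ k) • op y := h3
          _ ≤ (K * b ^ k) • (b • y) := smul_le_smul_of_nonneg_left hb (by positivity)
          _ = _ := by rw [smul_smul, pow_succ, mul_assoc]
    exact fun k => (h1 k).trans (h2 k)
  obtain ⟨k, hk'⟩ := pow_unbounded_of_one_lt (K * y i0 / x i0) ((one_lt_div hb0).2 hab)
  have h3 := hk k i0
  simp only [Pi.smul_apply, smul_eq_mul] at h3
  rw [div_pow, div_lt_div_iff₀ (hx i0) (by positivity)] at hk'
  nlinarith

/-- Perron-Frobenius: growth rates under a primitive nonnegative linear map. -/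
theorem perron {ι : Type*} [Fintype ι] [Nonempty ι] (op : (ι → ℝ) →ₗ[ℝ] (ι → ℝ))
    (hop : ∀ f, 0 ≤ f → 0 ≤ op f) (m : ℕ) (hm : ∀ f, 0 ≤ f → ∀ i j, f j ≤ (op ^ m) f i)
    (d : ℕ → ι → ℝ) (hd : ∀ n, d (n + 1) = op (d n)) (hd0 : ∀ n i, 0 < d n i) :
    ∃ lam : ℝ, (∀ i, Good lam (fun n => d n i)) ∧
      (∀ v a, (∀ i, 0 < v i) → a • v ≤ op v → a ≤ lam) ∧
      (∀ v b, (∀ i, 0 < v i) → 0 < b → op v ≤ b • v → lam ≤ b) := by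
  have i0 : ι := Classical.arbitrary ι
  have mono : ∀ f g : ι → ℝ, f ≤ g → op f ≤ op g := by
    intro f g hfg
    have := hop (g - f) (sub_nonneg.2 hfg)
    rw [map_sub] at this
    exact sub_nonneg.1 this
  have hpow : ∀ k n, d (n + k) = (op ^ k) (d n) := by
    intro k n
    induction k with
    | zero => rfl
    | succ k ih => rw [← add_assoc, hd, ih, pow_succ']; rfl
  let L : ℕ → ℝ → Prop := fun n a => a • d n ≤ d (n + 1)
  let U : ℕ → ℝ → Prop := fun n b => d (n + 1) ≤ b • d n
  have hL : ∀ n a, L n a → ∀ n' ≥ n, L n' a := by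
    intro n a h n' hn'
    induction n', hn' using Nat.le_induction with
    | base => exact h
    | succ n' _ ih =>
      have := mono _ _ ih
      rw [map_smul, ← hd, ← hd] at this
      exact this
  have hU : ∀ n b, U n b → ∀ n' ≥ n, U n' b := by
    intro n b h n' hn'
    induction n', hn' using Nat.le_induction with
    | base => exact h
    | succ n' _ ih =>
      have := mono _ _ ih
      rw [map_smul, ← hd, ← hd] at this
      exact this
  have hLU : ∀ n a n' b, L n a → U n' b → a ≤ b := by
    intro n a n' b h1 h2
    have h3 := hL n a h1 (n + n') (by omega) i0
    have h4 := hU n' b h2 (n + n') (by omega) i0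
    exact le_of_mul_le_mul_right (h3.trans h4) (hd0 _ i0)
  have hL0 : L 0 0 := by
    intro i
    simp only [Pi.smul_apply, zero_smul]
    exact (hd0 1 i).le
  obtain ⟨B, hB1, hB⟩ : ∃ B : ℝ, 1 ≤ B ∧ U 0 B := by
    refine ⟨1 + ∑ i, d 1 i / d 0 i, ?_, ?_⟩
    · have : 0 ≤ ∑ i, d 1 i / d 0 i :=
        Finset.sum_nonneg fun i _ => (div_pos (hd0 1 i) (hd0 0 i)).le
      linarith
    · intro i
      have h1 := Finset.single_le_sum (f := fun i => d 1 i / d 0 i)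
        (fun i _ => (div_pos (hd0 1 i) (hd0 0 i)).le) (Finset.mem_univ i)
      have h2 : d 1 i = d 1 i / d 0 i * d 0 i := (div_mul_cancel₀ _ (hd0 0 i).ne').symm
      simp only [Pi.smul_apply, smul_eq_mul, zero_add]
      rw [h2]
      refine mul_le_mul_of_nonneg_right ?_ (hd0 0 i).le
      linarith
  have hBk : ∀ k n i, d (n + k) i ≤ B ^ k * d n i := by
    intro k n i
    induction k with
    | zero => simp
    | succ k ih =>
      have h1 := hU 0 B hB (n + k) (by omega) i
      simp only [Pi.smul_apply, smul_eq_mul] at h1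
      rw [pow_succ', mul_assoc, ← add_assoc]
      exact h1.trans (mul_le_mul_of_nonneg_left ih (by linarith))
  have hBp : (1 : ℝ) ≤ B ^ (2 * m) := one_le_pow₀ hB1
  obtain ⟨κ, hκ⟩ : ∃ κ, κ = (B ^ (2 * m))⁻¹ := ⟨_, rfl⟩
  have hκ0 : 0 < κ := by rw [hκ]; positivity
  have hκ1 : κ ≤ 1 := by rw [hκ]; exact inv_le_one_of_one_le₀ hBp
  have hκd : ∀ n ≥ m, ∀ i j, κ * d (n + m) i ≤ d n j := by
    intro n hn i j
    obtain ⟨k, rfl⟩ : ∃ k, n = k + m := ⟨n - m, by omega⟩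
    have h1 : d k i ≤ d (k + m) j := by
      rw [hpow m k]; exact hm _ (fun i => (hd0 k i).le) j i
    have h2 := hBk (2 * m) k i
    have h3 : k + m + m = k + 2 * m := by omega
    rw [h3, hκ]
    refine le_trans ?_ h1
    rw [inv_mul_le_iff₀ (by positivity)]
    exact h2
  have step : ∀ n ≥ m, ∀ a b, L n a → U n b → ∃ a' b', L (n + m) a' ∧ U (n + m) b' ∧
      b' - a' = (1 - κ / 2) * (b - a) := by
    intro n hn a b ha hb
    have hab : a ≤ b := hLU n a n b ha hb
    by_cases hc : (a + b) / 2 * d n i0 ≤ d (n + 1) i0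
    · refine ⟨a + κ / 2 * (b - a), b, ?_, hU n b hb _ (by omega), by ring⟩
      intro i
      have h1 := hm (d (n + 1) - a • d n) (sub_nonneg.2 ha) i i0
      rw [map_sub, map_smul, ← hpow, ← hpow] at h1
      simp only [Pi.sub_apply, Pi.smul_apply, smul_eq_mul] at h1 ⊢
      have h2 := hκd n hn i i0
      have h3 : n + 1 + m = n + m + 1 := by omega
      rw [h3] at h1
      have h4 : (b - a) * (κ * d (n + m) i) ≤ (b - a) * d n i0 :=
        mul_le_mul_of_nonneg_left h2 (by linarith)
      nlinarith
    · refine ⟨a, b - κ / 2 * (b - a), hL n a ha _ (by omega), ?_, by ring⟩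
      intro i
      have h1 := hm (b • d n - d (n + 1)) (sub_nonneg.2 hb) i i0
      rw [map_sub, map_smul, ← hpow, ← hpow] at h1
      simp only [Pi.sub_apply, Pi.smul_apply, smul_eq_mul] at h1 ⊢
      have h2 := hκd n hn i i0
      have h3 : n + 1 + m = n + m + 1 := by omega
      rw [h3] at h1
      have h4 : (b - a) * (κ * d (n + m) i) ≤ (b - a) * d n i0 :=
        mul_le_mul_of_nonneg_left h2 (by linarith)
      nlinarith
  have gap : ∀ k : ℕ, ∃ n ≥ m, ∃ a b, L n a ∧ U n b ∧ b - a = (1 - κ / 2) ^ k * B := by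
    intro k
    induction k with
    | zero => exact ⟨m, le_rfl, 0, B, hL _ _ hL0 _ (by omega), hU _ _ hB _ (by omega), by simp⟩
    | succ k ih =>
      obtain ⟨n, hn, a, b, ha, hb, hab⟩ := ih
      obtain ⟨a', b', h1, h2, h3⟩ := step n hn a b ha hb
      refine ⟨n + m, by omega, a', b', h1, h2, ?_⟩
      rw [h3, hab, pow_succ]; ring
  let S : Set ℝ := {a | ∃ n, L n a}
  have hSne : S.Nonempty := ⟨0, 0, hL0⟩
  have hSb : ∀ n b, U n b → b ∈ upperBounds S := by
    rintro n b hb a ⟨n', ha⟩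
    exact hLU _ _ _ _ ha hb
  have hlow : ∀ n a, L n a → a ≤ sSup S := fun n a ha => le_csSup ⟨B, hSb 0 B hB⟩ ⟨n, ha⟩
  have hupp : ∀ n b, U n b → sSup S ≤ b := fun n b hb => csSup_le hSne (hSb n b hb)
  have hB0 : 0 < B := by linarith
  have hUpos : ∀ n b, U n b → 0 < b := by
    intro n b hb
    have h1 := (hd0 (n + 1) i0).trans_le (hb i0)
    exact pos_of_mul_pos_left h1 (hd0 n i0).le
  have gap' : ∀ ε > 0, ∃ n a b, L n a ∧ U n b ∧ b - a < ε := by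
    intro ε hε
    obtain ⟨k, hk⟩ := exists_pow_lt_of_lt_one (div_pos hε hB0) (by linarith : 1 - κ / 2 < 1)
    obtain ⟨n, hn, a, b, ha, hb, hab⟩ := gap k
    rw [lt_div_iff₀ hB0] at hk
    exact ⟨n, a, b, ha, hb, by rw [hab]; exact hk⟩
  refine ⟨sSup S, fun i => ⟨Filter.Eventually.of_forall fun n => hd0 n i, ?_⟩, ?_, ?_⟩
  · intro ε hε
    obtain ⟨n, a, b, ha, hb, hab⟩ := gap' ε hε
    filter_upwards [Filter.eventually_ge_atTop n] with n' hn'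
    have h1 := hL n a ha n' hn' i
    have h2 := hU n b hb n' hn' i
    simp only [Pi.smul_apply, smul_eq_mul] at h1 h2
    have h3 := hlow n a ha
    have h4 := hupp n b hb
    have h5 := hd0 n' i
    rw [abs_le]
    constructor <;> nlinarith
  · intro v a hv ha
    refine le_of_forall_pos_le_add fun ε hε => ?_
    obtain ⟨n, a', b, ha', hb, hab⟩ := gap' ε hε
    have h1 := cw op hop v (d n) hv (hd0 n) a b (hUpos n b hb) ha (by rw [← hd]; exact hb)
    have h2 := hlow n a' ha'
    linarith
  · intro v b hv hb0 hb
    refine csSup_le hSne ?_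
    rintro a ⟨n, ha⟩
    exact cw op hop (d n) v (hd0 n) hv a b hb0 (by rw [← hd]; exact ha) hb

/-! ### The common elements -/

/-- The common elements other than hydrogen. -/
def cs : List ℕ := [
    3, 12, 13, 132, 312, 1112, 1113, 3112, 3113, 11131, 11132, 13211, 31132, 32112, 111312,
    131112, 132112, 132113, 311311, 311312, 311332, 1112133, 1113222, 1321132, 1322112, 1322113,
    3112112, 3112221, 11131221, 11133112, 13122112, 13211312, 13211321, 31131112, 123222112,
    123222113, 311311222, 1113122112, 1113122113, 1113222112, 1113222113, 1321122112, 1321131112,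
    1321133112, 3113112211, 3113322112, 3113322113, 13221133112, 111213322112, 111213322113,
    111311222112, 111312211312, 132113212221, 311311222112, 311311222113, 1322113312211,
    11131221131112, 11131221131211, 11131221133112, 11131221222112, 31121123222112,
    31121123222113, 311322113212221, 3113112211322112, 3113112221131112, 3113112221133112,
    13221133122211332, 111312211312113211, 132112211213322112, 132112211213322113,
    311311222113111221, 13211321222113222112, 13211322211312113211, 132211331222113112211,
    12322211331222113112211, 31131122211311122113222, 111312212221121123222112,
    111312212221121123222113, 311311222113111221131221, 11131221131211322113322112,
    312211322212221121123222112, 312211322212221121123222113, 1113122113322113111221131221,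
    3113112211322112211213322112, 3113112211322112211213322113, 13112221133211322112211213322112,
    13112221133211322112211213322113, 1321132122211322212221121123222112,
    1321132122211322212221121123222113, 111312211312113221133211322112211213322112,
    111312211312113221133211322112211213322113]

/-- Indices of the decay products different from hydrogen. -/
def chs : List (List ℕ) := [
    [2], [5], [6], [14], [15], [7], [8], [16], [17], [18], [19], [28], [31], [30], [33], [29],
    [37], [38], [32], [42], [3, 1, 4], [26, 0], [20], [51], [39], [40], [41], [3, 11], [44],
    [4, 13], [50], [56], [57], [43], [48], [49], [23, 3], [53], [54], [45], [46], [59], [58],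
    [9, 1, 13], [52], [3, 34], [3, 35], [22, 1, 13], [60], [61], [12, 24], [64], [67], [23, 24],
    [23, 25], [22, 1, 27], [65], [70], [36, 1, 13], [63], [68], [69], [72], [71], [23, 47],
    [23, 2, 1, 13], [22, 1, 8, 1, 4], [78], [76], [77], [23, 55], [79], [82], [22, 1, 62],
    [21, 1, 62], [23, 66], [83], [84], [23, 73], [75, 34], [85], [86], [36, 74], [87], [88],
    [10, 2, 1, 80], [10, 2, 1, 81], [89], [90], [75, 1, 80], [75, 1, 81]]

/-- An approximate eigenvector of the decay matrix. -/
def ev : List ℕ := [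
    100000, 130358, 130358, 225336, 195594, 169931, 169931, 221519, 221519, 282654, 303441,
    247059, 323975, 237684, 293743, 254972, 288767, 288767, 368461, 395558, 422904, 256250,
    324418, 437134, 202538, 202538, 234041, 362383, 322060, 332376, 309839, 422327, 480318,
    382916, 223324, 223324, 508194, 376430, 376430, 264024, 264024, 305091, 515641, 499161,
    419831, 344176, 344176, 531199, 291120, 291120, 403899, 569838, 547282, 490705, 490705,
    626859, 550536, 626131, 672177, 397710, 379498, 379498, 555753, 518445, 742828, 717666,
    768843, 713424, 494705, 494705, 816210, 675833, 724467, 775197, 722904, 925129, 644886,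
    644886, 930003, 881001, 806728, 806728, 944399, 840658, 840658, 1051632, 1051632, 1095863,
    1095863, 1428542, 1428542]

/-- The `j`-th entry of a list. -/
noncomputable def nth (l : List ℕ) : ℕ → ℕ :=
  List.rec (fun _ => 0) (fun a _ r j => Nat.rec a (fun k _ => r k) j) l

/-- The `i`-th common element. -/
noncomputable def ew (i : ℕ) : List ℕ := dec (nth cs i)

def chi (i : ℕ) : List ℕ := chs.getD i []

theorem cs_length : cs.length = 91 := rfl
theorem chs_length : chs.length = 91 := rfl

theorem chk_ch : ((List.range 91).all fun i =>
    decide ((atoms (C (ew i))).filter (fun b => !leq b [2, 2]) = (chi i).map ew) &&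
      ((chi i).all fun j => decide (j < 91)) && !(chi i).isEmpty) = true := by
  decide +kernel

theorem chk_dv0 : ((List.range 91).all fun i =>
    Nat.ble ((C^[6] (ew i)).length + 1) (C^[7] (ew i)).length) = true := by decide +kernel

theorem chk_ev : ((List.range 91).all fun i =>
    Nat.ble 1 (nth ev i) && (Nat.ble (130351 * nth ev i) (100000 * ((chi i).map (nth ev)).sum) &&
    Nat.ble (100000 * ((chi i).map (nth ev)).sum) (130359 * nth ev i))) = true := by decide +kernel

/-- Evaluate the argument, then apply the function. -/
noncomputable def frc (x : ℕ) (k : ℕ → Bool) : Bool := Nat.rec (k 0) (fun n _ => k (Nat.succ n)) x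

/-- The union of the masks in `r` with index in `l`. -/
noncomputable def orl (r : List ℕ) (l : List ℕ) : ℕ :=
  List.rec 0 (fun j _ s => Nat.lor (nth r j) s) l

/-- One day of decay on masks, for the elements with the decay products `t`. -/
noncomputable def stp (r : List ℕ) (t : List (List ℕ)) : (List ℕ → Bool) → Bool :=
  List.rec (fun k => k []) (fun l _ ih k => frc (orl r l) fun v => ih fun u => k (v :: u)) t

/-- All elements are present after `n` days of decay. -/
noncomputable def rchk (n : ℕ) : List ℕ → Bool :=
  Nat.rec (fun r => r.all fun m => Nat.beq m (2 ^ 91 - 1)) (fun _ ih r => stp r chs ih) n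

theorem chk_r : rchk 44 ((List.range 91).map fun i => 2 ^ i) = true := by decide +kernel

theorem chk_cover : (ebt.toL.all fun n => Nat.beq n 22 || Nat.beq n 312211322212221121123222114 ||
    Nat.beq n 13112221133211322112211213322114 || cs.any fun m => Nat.beq n m) = true := by
  decide +kernel

theorem chk_pu : atoms (C (dec 312211322212221121123222114)) =
    [dec 13112221133211322112211213322114] := by decide +kernel

theorem chk_np : atoms (C (dec 13112221133211322112211213322114)) =
    [dec 11132, dec 13, dec 22, dec 12, dec 312211322212221121123222114] := by decide +kernel

/-! ### The growth rate of the elements -/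

theorem nth_eq (l : List ℕ) (i : ℕ) : nth l i = l.getD i 0 := by
  induction l generalizing i with
  | nil => rfl
  | cons a l ih =>
    cases i with
    | zero => rfl
    | succ i =>
      rw [List.getD_cons_succ, ← ih]; rfl

theorem nth_map_chs (g : List ℕ → ℕ) {i : ℕ} (h : i < 91) : nth (chs.map g) i = g (chi i) := by
  have h1 : i < chs.length := h
  rw [nth_eq, chi, List.getD_eq_getElem _ _ (by simpa using h1), List.getD_eq_getElem _ _ h1,
    List.getElem_map]

theorem frc_eq (x : ℕ) (k : ℕ → Bool) : frc x k = k x := by cases x <;> rfl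

theorem stp_eq (r : List ℕ) (t : List (List ℕ)) (k : List ℕ → Bool) :
    stp r t k = k (t.map (orl r)) := by
  induction t generalizing k with
  | nil => rfl
  | cons l t ih =>
    change frc (orl r l) (fun v => stp r t fun u => k (v :: u)) = _
    rw [frc_eq, ih]; rfl

theorem orl_testBit {r l : List ℕ} {j : ℕ} (h : (orl r l).testBit j = true) :
    ∃ c ∈ l, (nth r c).testBit j = true := by
  induction l with
  | nil =>
    change (0 : ℕ).testBit j = true at h
    simp at h
  | cons c l ih =>
    change (nth r c ||| orl r l).testBit j = true at h
    rw [Nat.testBit_lor, Bool.or_eq_true] at h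
    rcases h with h | h
    · exact ⟨c, by simp, h⟩
    · obtain ⟨c', h1, h2⟩ := ih h
      exact ⟨c', by simp [h1], h2⟩

theorem chi_prop {i : ℕ} (h : i < 91) :
    (atoms (C (ew i))).filter (fun b => !leq b [2, 2]) = (chi i).map ew ∧
      (∀ j ∈ chi i, j < 91) ∧ chi i ≠ [] := by
  have h1 := List.all_eq_true.1 chk_ch i (List.mem_range.2 h)
  rw [Bool.and_eq_true, Bool.and_eq_true, decide_eq_true_eq, List.all_eq_true] at h1
  refine ⟨h1.1.1, fun j hj => of_decide_eq_true (h1.1.2 j hj), ?_⟩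
  have h2 := h1.2
  intro h3
  rw [h3] at h2
  simp at h2

/-- The decay operator. -/
noncomputable def op : (Fin 91 → ℝ) →ₗ[ℝ] (Fin 91 → ℝ) where
  toFun f i := ((chi i).map fun j => f (Fin.ofNat 91 j)).sum
  map_add' f g := by
    funext i
    simp only [Pi.add_apply]
    rw [List.sum_map_add]
  map_smul' c f := by
    funext i
    simp only [Pi.smul_apply, smul_eq_mul, RingHom.id_apply]
    rw [List.sum_map_mul_left]

theorem op_apply (f : Fin 91 → ℝ) (i : Fin 91) :
    op f i = ((chi i).map fun j => f (Fin.ofNat 91 j)).sum := rfl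

theorem op_nonneg (f : Fin 91 → ℝ) (hf : 0 ≤ f) : 0 ≤ op f := by
  intro i
  rw [op_apply]
  refine List.sum_nonneg ?_
  intro x hx
  obtain ⟨j, -, rfl⟩ := List.mem_map.1 hx
  exact hf _

theorem op_pow_nonneg (k : ℕ) (f : Fin 91 → ℝ) (hf : 0 ≤ f) : 0 ≤ (op ^ k) f := by
  induction k with
  | zero => exact hf
  | succ k ih => rw [pow_succ']; exact op_nonneg _ ih

theorem ofNat_val {j : ℕ} (h : j < 91) : ((Fin.ofNat 91 j : Fin 91) : ℕ) = j :=
  Nat.mod_eq_of_lt h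

theorem rchk_sound (n k : ℕ) (r : List ℕ) (hr : r.length = 91) (h : rchk n r = true)
    (inv : ∀ i : Fin 91, ∀ j : Fin 91, (nth r i).testBit j = true →
      ∀ f : Fin 91 → ℝ, 0 ≤ f → f j ≤ (op ^ k) f i) :
    ∀ f : Fin 91 → ℝ, 0 ≤ f → ∀ i j, f j ≤ (op ^ (k + n)) f i := by
  induction n generalizing k r with
  | zero =>
    intro f hf i j
    refine inv i j ?_ f hf
    have h1 : (r.all fun m => Nat.beq m (2 ^ 91 - 1)) = true := h
    rw [List.all_eq_true] at h1
    have hi : (i : ℕ) < r.length := by rw [hr]; exact i.2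
    have h2 := h1 r[(i : ℕ)] (List.getElem_mem hi)
    rw [Nat.beq_eq] at h2
    rw [nth_eq, List.getD_eq_getElem _ _ hi, h2, Nat.testBit_two_pow_sub_one]
    simp
  | succ n ih =>
    have h1 : stp r chs (rchk n) = true := h
    rw [stp_eq] at h1
    have h2 := ih (k + 1) _ (by simp [chs_length]) h1 ?_
    · have e : k + (n + 1) = k + 1 + n := by omega
      rw [e]; exact h2
    · intro i j hij f hf
      rw [nth_map_chs _ i.2] at hij
      obtain ⟨c, hc, h3⟩ := orl_testBit hij
      have hc91 := (chi_prop i.2).2.1 c hc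
      have h4 := inv (Fin.ofNat 91 c) j (by rw [ofNat_val hc91]; exact h3) f hf
      refine h4.trans ?_
      rw [pow_succ']
      change _ ≤ op ((op ^ k) f) i
      rw [op_apply]
      refine List.single_le_sum ?_ _ (List.mem_map.2 ⟨c, hc, rfl⟩)
      intro x hx
      obtain ⟨j, -, rfl⟩ := List.mem_map.1 hx
      exact op_pow_nonneg k f hf _

theorem op_primitive : ∀ f : Fin 91 → ℝ, 0 ≤ f → ∀ i j, f j ≤ (op ^ 44) f i := by
  have h := rchk_sound 44 0 _ (by simp) chk_r ?_
  · simpa using h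
  · intro i j hij f hf
    rw [nth_eq, List.getD_eq_getElem _ _ (by simp)] at hij
    simp only [List.getElem_map, List.getElem_range] at hij
    rw [Nat.testBit_two_pow] at hij
    have : i = j := Fin.ext (of_decide_eq_true hij)
    rw [this]; exact le_rfl

/-- The increment of the length. -/
noncomputable def dl (x : List ℕ) (n : ℕ) : ℝ :=
  ((C^[n + 1] x).length : ℝ) - ((C^[n] x).length : ℝ)

theorem dl_append {u v : List ℕ} (h : ∀ n, C^[n] (u ++ v) = C^[n] u ++ C^[n] v) (n : ℕ) :
    dl (u ++ v) n = dl u n + dl v n := by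
  simp only [dl, h, List.length_append, Nat.cast_add]; ring

theorem dl_atoms (n : ℕ) (x : List ℕ) : dl x n = ((atoms x).map fun b => dl b n).sum := by
  induction hm : x.length using Nat.strong_induction_on generalizing x with
  | _ m ih =>
    by_cases hx : x = []
    · subst hx
      have h : ∀ n, C^[n] ([] : List ℕ) = [] := fun n => Function.iterate_fixed C_nil n
      simp [dl, h, atoms_nil]
    · obtain ⟨b, rest, h2, h3, h4, h5⟩ := atoms_struct x hx
      rw [h3, List.map_cons, List.sum_cons]
      rcases h5 with rfl | h5
      · rw [h2]; simp [atoms_nil]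
      · rw [← ih rest.length ?_ rest rfl, h2, dl_append fun n => (splits_iter h5 n).1]
        rw [← hm, h2, List.length_append]
        have := List.length_pos_iff.2 h4
        omega

theorem C_22 : C [2, 2] = [2, 2] := rfl

theorem dl_22 (n : ℕ) : dl [2, 2] n = 0 := by
  simp only [dl, Function.iterate_fixed C_22, sub_self]

theorem sum_filter (F : List ℕ → ℝ) (hF : F [2, 2] = 0) (l : List (List ℕ)) :
    (l.map F).sum = ((l.filter fun b => !leq b [2, 2]).map F).sum := by
  induction l with
  | nil => rfl
  | cons b l ih =>
    cases h : leq b [2, 2] with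
    | true =>
      rw [List.filter_cons_of_neg (by simp [h]), ← ih, List.map_cons, List.sum_cons, leq_eq h, hF,
        zero_add]
    | false =>
      rw [List.filter_cons_of_pos (by simp [h]), List.map_cons, List.map_cons, List.sum_cons,
        List.sum_cons, ih]

theorem dl_succ (x : List ℕ) (n : ℕ) : dl x (n + 1) = ((atoms (C x)).map fun b => dl b n).sum := by
  rw [← dl_atoms]; rfl

theorem dl_ew {i : ℕ} (hi : i < 91) (n : ℕ) :
    dl (ew i) (n + 1) = ((chi i).map fun j => dl (ew j) n).sum := by
  rw [dl_succ, sum_filter _ (dl_22 n), (chi_prop hi).1, List.map_map]; rfl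

theorem dl_ew_pos (n : ℕ) {i : ℕ} (hi : i < 91) : 0 < dl (ew i) (n + 6) := by
  induction n generalizing i with
  | zero =>
    have h1 := List.all_eq_true.1 chk_dv0 i (List.mem_range.2 hi)
    rw [Nat.ble_eq] at h1
    rw [dl, sub_pos, Nat.cast_lt]
    exact h1
  | succ n ih =>
    rw [add_right_comm, dl_ew hi]
    refine List.sum_pos _ ?_ ?_
    · intro x hx
      obtain ⟨j, hj, rfl⟩ := List.mem_map.1 hx
      exact ih ((chi_prop hi).2.1 j hj)
    · simpa using (chi_prop hi).2.2

theorem common_good : ∃ lam : ℝ, 1.3035 < lam ∧ lam < 1.3036 ∧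
    ∀ i < 91, Good lam (dl (ew i)) := by
  obtain ⟨lam, h1, h2, h3⟩ := perron op op_nonneg 44 op_primitive
    (fun n i => dl (ew i) (n + 6)) (by
      intro n
      funext i
      rw [op_apply, add_right_comm, dl_ew i.2]
      congr 1
      refine List.map_congr_left fun j hj => ?_
      rw [ofNat_val ((chi_prop i.2).2.1 j hj)])
    (fun n i => dl_ew_pos n i.2)
  have hv : ∀ i : Fin 91, 1 ≤ nth ev i ∧
      130351 * nth ev i ≤ 100000 * ((chi i).map (nth ev)).sum ∧
      100000 * ((chi i).map (nth ev)).sum ≤ 130359 * nth ev i := by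
    intro i
    have h := List.all_eq_true.1 chk_ev i (List.mem_range.2 i.2)
    rwa [Bool.and_eq_true, Bool.and_eq_true, Nat.ble_eq, Nat.ble_eq, Nat.ble_eq] at h
  have hop : ∀ i : Fin 91, op (fun j => (nth ev j : ℝ)) i
      = ((((chi i).map (nth ev)).sum : ℕ) : ℝ) := by
    intro i
    rw [op_apply, Nat.cast_list_sum, List.map_map]
    congr 1
    refine List.map_congr_left fun j hj => ?_
    rw [ofNat_val ((chi_prop i.2).2.1 j hj)]; rfl
  have hpos : ∀ i : Fin 91, (0 : ℝ) < (nth ev i : ℝ) := fun i => by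
    exact_mod_cast (hv i).1
  refine ⟨lam, ?_, ?_, ?_⟩
  · have h4 := h2 (fun j => (nth ev j : ℝ)) 1.30351 hpos (by
      intro i
      rw [hop]
      have h5 : (130351 : ℝ) * nth ev i ≤ 100000 * (((chi i).map (nth ev)).sum : ℕ) := by
        exact_mod_cast (hv i).2.1
      simp only [Pi.smul_apply, smul_eq_mul]
      rw [show (1.30351 : ℝ) = 130351 / 100000 by norm_num]
      linarith)
    norm_num at h4 ⊢
    linarith
  · have h4 := h3 (fun j => (nth ev j : ℝ)) 1.30359 hpos (by norm_num) (by
      intro i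
      rw [hop]
      have h5 : (100000 : ℝ) * (((chi i).map (nth ev)).sum : ℕ) ≤ 130359 * nth ev i := by
        exact_mod_cast (hv i).2.2
      simp only [Pi.smul_apply, smul_eq_mul]
      rw [show (1.30359 : ℝ) = 130359 / 100000 by norm_num]
      linarith)
    norm_num at h4 ⊢
    linarith
  · intro i hi
    exact (good_shift 6).1 (h1 ⟨i, hi⟩)

theorem cs_mem {n : ℕ} (h : n ∈ cs) : ∃ i < 91, dec n = ew i := by
  obtain ⟨i, hi, rfl⟩ := List.mem_iff_getElem.1 h
  exact ⟨i, hi, by rw [ew, nth_eq, List.getD_eq_getElem _ _ hi]⟩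

/-! ### Growth of general words -/

/-- The word becomes `22` or empty, or grows with rate `lam`. -/
def Gr (lam : ℝ) (x : List ℕ) : Prop :=
  (∃ N, ∀ n ≥ N, ∀ c ∈ C^[n] x, c = 2) ∨ Good lam (dl x)

theorem Gr_C {lam : ℝ} {x : List ℕ} (h : Gr lam (C x)) : Gr lam x := by
  rcases h with ⟨N, h⟩ | h
  · left
    refine ⟨N + 1, fun n hn => ?_⟩
    obtain ⟨k, rfl⟩ : ∃ k, n = k + 1 := ⟨n - 1, by omega⟩
    exact h k (by omega)
  · right
    exact (good_shift 1).1 h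

theorem Gr_iter {lam : ℝ} {x : List ℕ} (n : ℕ) (h : Gr lam (C^[n] x)) : Gr lam x := by
  induction n with
  | zero => exact h
  | succ n ih => rw [Function.iterate_succ_apply'] at h; exact ih (Gr_C h)

theorem two_cases {y : List ℕ} (h1 : ∀ c ∈ y, c = 2) (h2 : ∀ c ∈ C y, c = 2) :
    y = [] ∨ y = [2, 2] := by
  have h3 := List.eq_replicate_of_mem h1
  generalize y.length = k at h3
  subst h3
  cases k with
  | zero => left; rfl
  | succ k =>
    rw [C_replicate] at h2
    have : k + 1 = 2 := h2 _ (by simp)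
    obtain rfl : k = 1 := by omega
    right; rfl

theorem dl_two {u : List ℕ} {N : ℕ} (h : ∀ n ≥ N, ∀ c ∈ C^[n] u, c = 2) (n : ℕ) (hn : n ≥ N) :
    dl u n = 0 := by
  have h1 := h (n + 1) (by omega)
  rw [Function.iterate_succ_apply'] at h1
  rw [dl, Function.iterate_succ_apply']
  rcases two_cases (h n hn) h1 with h2 | h2
  · rw [h2, C_nil, sub_self]
  · rw [h2, C_22, sub_self]

theorem Gr_app {lam : ℝ} {u v : List ℕ} (h : ∀ n, C^[n] (u ++ v) = C^[n] u ++ C^[n] v)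
    (hu : Gr lam u) (hv : Gr lam v) : Gr lam (u ++ v) := by
  rcases hu with ⟨N, hu⟩ | hu
  · rcases hv with ⟨M, hv⟩ | hv
    · left
      refine ⟨N + M, fun n hn c hc => ?_⟩
      rw [h, List.mem_append] at hc
      rcases hc with hc | hc
      · exact hu n (by omega) c hc
      · exact hv n (by omega) c hc
    · right
      refine hv.congr N fun n hn => ?_
      rw [dl_append h, dl_two hu n hn, zero_add]
  · rcases hv with ⟨M, hv⟩ | hv
    · right
      refine hu.congr M fun n hn => ?_
      rw [dl_append h, dl_two hv n hn, add_zero]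
    · right
      refine (hu.add hv).congr 0 fun n _ => ?_
      rw [dl_append h]

theorem Gr_swap {lam : ℝ} {f : ℕ → ℕ} {x : List ℕ} (hf : Function.Injective f)
    (h3 : ∀ k ≤ 3, f k = k) (h : ∀ n, C^[n] (x.map f) = (C^[n] x).map f)
    (hx : Gr lam (x.map f)) : Gr lam x := by
  rcases hx with ⟨N, hx⟩ | hx
  · left
    refine ⟨N, fun n hn c hc => hf ?_⟩
    rw [h3 2 (by norm_num)]
    refine hx n hn (f c) ?_
    rw [h]
    exact List.mem_map_of_mem hc
  · right
    refine hx.congr 0 fun n _ => ?_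
    simp only [dl, h, List.length_map]

theorem transuranic_good {lam : ℝ} (hlam : 1 < lam) (h : ∀ i < 91, Good lam (dl (ew i))) :
    Good lam (dl (dec 312211322212221121123222114)) ∧
      Good lam (dl (dec 13112221133211322112211213322114)) := by
  have hc : ∀ n ∈ cs, Good lam (dl (dec n)) := by
    intro n hn
    obtain ⟨i, hi, h1⟩ := cs_mem hn
    rw [h1]; exact h i hi
  have h1 := hc 11132 (by decide)
  have h2 := hc 13 (by decide)
  have h3 := hc 12 (by decide)
  have e1 : ∀ n, dl (dec 312211322212221121123222114) (n + 1)
      = dl (dec 13112221133211322112211213322114) n := by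
    intro n
    rw [dl_succ, chk_pu]; simp
  have e2 : ∀ n, dl (dec 13112221133211322112211213322114) (n + 1)
      = dl (dec 11132) n + (dl (dec 13) n + (dl (dec 12) n +
        dl (dec 312211322212221121123222114) n)) := by
    intro n
    have e3 : dl (dec 22) n = 0 := dl_22 n
    rw [dl_succ, chk_np]; simp [e3]
  have hpu : Good lam (dl (dec 312211322212221121123222114)) := by
    refine good_lag hlam (s := 2) (by norm_num) ((h1.add h2).add h3) fun n => ?_
    rw [show n + 2 = n + 1 + 1 from rfl, e1, e2]; ring
  refine ⟨hpu, (good_shift (d := dl (dec 13112221133211322112211213322114)) 0).1 ?_⟩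
  exact ((good_shift 1).2 hpu).congr 0 fun n _ => (e1 n).symm

theorem isE_Gr {lam : ℝ} (hlam : 1 < lam) (h : ∀ i < 91, Good lam (dl (ew i))) {b : List ℕ}
    (hb : isE b = true) : Gr lam b := by
  obtain ⟨n, h1, rfl⟩ := isE_mem hb
  have h2 := List.all_eq_true.1 chk_cover n h1
  simp only [Bool.or_eq_true, Nat.beq_eq, List.any_eq_true] at h2
  rcases h2 with ((rfl | rfl) | rfl) | ⟨m, hm, rfl⟩
  · left
    refine ⟨0, fun n _ c hc => ?_⟩
    have e : C^[n] (dec 22) = [2, 2] := Function.iterate_fixed C_22 n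
    rw [e] at hc
    simpa using hc
  · right; exact (transuranic_good hlam h).1
  · right; exact (transuranic_good hlam h).2
  · right
    obtain ⟨i, hi, h3⟩ := cs_mem hm
    rw [h3]; exact h i hi

theorem Gr_all {lam : ℝ} (hlam : 1 < lam) (h : ∀ i < 91, Good lam (dl (ew i))) (x : List ℕ)
    (hx : ∀ c ∈ x, 1 ≤ c) : Gr lam x := by
  refine reduction (Q := Gr lam) ?_ (fun x => Gr_C) (fun u v => Gr_app)
    (fun f x hf h3 hC hQ => Gr_swap hf h3 hC hQ) x hx
  rintro x ⟨N, hN⟩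
  refine Gr_iter N (atoms_induction (P := Gr lam) ?_ ?_ _ fun b hb => isE_Gr hlam h (hN b hb))
  · left
    refine ⟨0, fun n _ c hc => ?_⟩
    rw [Function.iterate_fixed C_nil] at hc
    simp at hc
  · intro u v huv hu hv
    exact Gr_app (fun n => (splits_iter huv n).1) hu hv

theorem C_eq_22 {y : List ℕ} (h : C y = [2, 2]) : y = [2, 2] := by
  cases y with
  | nil => simp [C_nil] at h
  | cons a t =>
    have e := lead_drp a t
    rw [C_run] at h
    simp only [List.cons.injEq] at h
    obtain ⟨h1, rfl, h2⟩ := h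
    have h3 : drp 2 t = [] := by
      by_contra h4
      exact C_ne_nil h4 h2
    rw [h3, show lead 2 t = 1 by omega] at e
    rw [e]; rfl

theorem main_ratio {lam : ℝ} (hlam : 1 < lam) (h : ∀ i < 91, Good lam (dl (ew i))) (x : List ℕ)
    (hx : ∀ c ∈ x, 1 ≤ c) (hx0 : x ≠ []) (hx2 : x ≠ [2, 2]) :
    Filter.Tendsto (fun n : ℕ => ((C^[n + 1] x).length : ℝ) / ((C^[n] x).length : ℝ))
      Filter.atTop (nhds lam) := by
  rcases Gr_all hlam h x hx with ⟨N, hN⟩ | hg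
  · exfalso
    have hne : ∀ n, C^[n] x ≠ [] := by
      intro n
      induction n with
      | zero => exact hx0
      | succ n ih => rw [Function.iterate_succ_apply']; exact C_ne_nil ih
    have hne2 : ∀ n, C^[n] x ≠ [2, 2] := by
      intro n
      induction n with
      | zero => exact hx2
      | succ n ih => rw [Function.iterate_succ_apply']; exact fun h => ih (C_eq_22 h)
    have h1 := hN (N + 1) (by omega)
    rw [Function.iterate_succ_apply'] at h1
    rcases two_cases (hN N le_rfl) h1 with h2 | h2
    · exact hne N h2
    · exact hne2 N h2
  · refine good_ratio (p := fun n => ((C^[n] x).length : ℝ)) ?_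
    refine good_lag hlam (s := 1) le_rfl hg fun n => ?_
    rw [dl]; ring

end LS

/-- Arithmetical Theorem: the lengths of the successive derivations of any
nonempty word other than `(2,2)` grow geometrically with a ratio
`λ ≈ 1.303557`, independent of the word. -/
theorem arithmetical_theorem :
    ∃ lam : ℝ, 1.3035 < lam ∧ lam < 1.3036 ∧
      ∀ x : List ℕ+, x ≠ [] → x ≠ [2, 2] →
        Filter.Tendsto
          (fun n : ℕ => ((lookAndSay^[n + 1] x).length : ℝ) / ((lookAndSay^[n] x).length : ℝ))
          Filter.atTop (nhds lam) := by
  obtain ⟨lam, h1, h2, h⟩ := LS.common_good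
  refine ⟨lam, h1, h2, fun x hx hx2 => ?_⟩
  have key := LS.main_ratio (by norm_num at h1; linarith) h (x.map PNat.val)
    (by
      intro c hc
      obtain ⟨d, -, rfl⟩ := List.mem_map.1 hc
      exact d.2)
    (by simpa using hx)
    (by
      intro he
      apply hx2
      have : x.map PNat.val = ([2, 2] : List ℕ+).map PNat.val := he
      exact (List.map_injective_iff.2 PNat.coe_injective) this)
  simpa only [← LS.map_lookAndSay_iter, List.length_map] using key
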